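/- arXiv:math/0207105 — 7 statements merged into one kernel-verified Lean document; each statement's English description precedes it below -/
import Mathlib

section
/- Let d ⊆ H_m be a design of cardinality k and let d̄ = H_m \ d be its complement, of cardinality h = 2^m − 1 − k. If d is a minimum aberration design, then d̄ has minimum rank: for every subset f ⊆ H_m with |f| = h one has rank(d̄) ≤ rank(f). -/
open Finset Polynomial

/-- The ambient 𝔽₂-vector space `V = (ZMod 2)^m`. -/
abbrev V (m : ℕ) := Fin m → ZMod 2

/-- `Hm m` is the set of the `2^m - 1` nonzero vectors of `V m`. -/
def Hm (m : ℕ) : Finset (V m) := Finset.univ.filter (fun v => v ≠ 0)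

/-- `Om m` is the set of odd-weight vectors of `V m`. -/
def Om (m : ℕ) : Finset (V m) := Finset.univ.filter (fun v => (∑ i, v i) = 1)

/-- `Em m` is the set of nonzero even-weight vectors of `V m`. -/
def Em (m : ℕ) : Finset (V m) := Finset.univ.filter (fun v => v ≠ 0 ∧ (∑ i, v i) = 0)

/-- The number of `i`-element subsets of `d` whose elements sum to `ψ`. -/
def sumCount (m : ℕ) (d : Finset (V m)) (i : ℕ) (ψ : V m) : ℕ :=
  ((d.powersetCard i).filter (fun S => S.sum id = ψ)).card

/-- `wordCount m d i = a_i(d)`, the number of `i`-element subsets of `d` summing to `0`. -/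
def wordCount (m : ℕ) (d : Finset (V m)) (i : ℕ) : ℕ := sumCount m d i 0

/-- The rank of a finite set of vectors: the dimension of its span over `𝔽₂`. -/
noncomputable def rankOf (m : ℕ) (f : Finset (V m)) : ℕ :=
  Module.finrank (ZMod 2) (Submodule.span (ZMod 2) (f : Set (V m)))

/-- `d₁` has smaller aberration than `d₂`. -/
def SmallerAberration (m : ℕ) (d₁ d₂ : Finset (V m)) : Prop :=
  ∃ s, 1 ≤ s ∧ wordCount m d₁ s < wordCount m d₂ s ∧
    ∀ t < s, wordCount m d₁ t = wordCount m d₂ t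

/-- `d` is a minimum aberration design. -/
def IsMA (m : ℕ) (d : Finset (V m)) : Prop :=
  d ⊆ Hm m ∧ ∀ d' ⊆ Hm m, d'.card = d.card → ¬ SmallerAberration m d' d

/-- The word-length pattern polynomial `P_f(X) = ∑ a_i(f) X^i` of a design `f`. -/
noncomputable def WLPP (m : ℕ) (f : Finset (V m)) : Polynomial ℤ :=
  ∑ i ∈ Finset.range (f.card + 1), (wordCount m f i : ℤ) • X ^ i

/-- `Q_ψ(X) = ∑ q_i(ψ) X^i`, where `q_i(ψ)` counts `i`-element subsets of `O_m` summing to `ψ`. -/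
noncomputable def Qpoly (m : ℕ) (ψ : V m) : Polynomial ℤ :=
  ∑ i ∈ Finset.range ((Om m).card + 1), (sumCount m (Om m) i ψ : ℤ) • X ^ i

/-- The number of pairs `(x, y) ∈ X × Y` with `x + y ∈ Z`. -/
def sumPairs {E : Type*} [AddCommGroup E] [DecidableEq E] (X Y Z : Finset E) : ℕ :=
  #{p ∈ X ×ˢ Y | p.1 + p.2 ∈ Z}

section Counting

variable {E : Type*} [AddCommGroup E] [DecidableEq E]

lemma sumPairs_comm (X Y Z : Finset E) : sumPairs X Y Z = sumPairs Y X Z := by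
  unfold sumPairs
  refine card_nbij' Prod.swap Prod.swap ?_ ?_ ?_ ?_ <;>
    simp +contextual [Set.MapsTo, Set.LeftInvOn, add_comm]

lemma sumPairs_le (X Y Z : Finset E) : sumPairs X Y Z ≤ #X * #Y := by
  unfold sumPairs
  exact (card_filter_le _ _).trans_eq (card_product _ _)

lemma sumPairs_eq_mul_iff {X Y Z : Finset E} :
    sumPairs X Y Z = #X * #Y ↔ ∀ x ∈ X, ∀ y ∈ Y, x + y ∈ Z := by
  unfold sumPairs
  rw [← card_product, card_filter_eq_iff]
  simp only [mem_product, Prod.forall, and_imp]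
  exact ⟨fun h x hx y hy => h x y hx hy, fun h x y hx hy => h x hx y hy⟩

lemma sumPairs_eq_zero {X Y Z : Finset E} (h : ∀ x ∈ X, ∀ y ∈ Y, x + y ∉ Z) :
    sumPairs X Y Z = 0 := by
  unfold sumPairs
  rw [card_eq_zero, filter_eq_empty_iff]
  rintro ⟨x, y⟩ hxy
  exact h x (mem_product.1 hxy).1 y (mem_product.1 hxy).2

lemma sumPairs_union_right (X Y : Finset E) {Z W : Finset E} (h : Disjoint Z W) :
    sumPairs X Y (Z ∪ W) = sumPairs X Y Z + sumPairs X Y W := by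
  unfold sumPairs
  simp only [mem_union]
  rw [filter_or, card_union_of_disjoint]
  exact disjoint_filter.2 fun p _ hp hp' => disjoint_left.1 h hp hp'

lemma sumPairs_union_left {X Y : Finset E} (h : Disjoint X Y) (Z W : Finset E) :
    sumPairs (X ∪ Y) Z W = sumPairs X Z W + sumPairs Y Z W := by
  unfold sumPairs
  rw [union_product, filter_union, card_union_of_disjoint]
  exact disjoint_filter_filter (disjoint_product.2 (.inl h))

variable [Module (ZMod 2) E]

lemma sumPairs_right_comm (X Y Z : Finset E) : sumPairs X Y Z = sumPairs X Z Y := by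
  unfold sumPairs
  have h (x y : E) : x + (x + y) = y := by
    rw [← add_assoc, ZModModule.add_self, zero_add]
  refine card_nbij' (fun p => (p.1, p.1 + p.2)) (fun p => (p.1, p.1 + p.2)) ?_ ?_ ?_ ?_ <;>
    simp +contextual [Set.MapsTo, Set.LeftInvOn, h]

/-- Splitting along a hyperplane: `A` lies on the hyperplane and `B` off it. -/
lemma sumPairs_union_self {A B : Finset E} (hAB : Disjoint A B)
    (hA : ∀ x ∈ A, ∀ y ∈ A, x + y ∉ B) (hB : ∀ x ∈ B, ∀ y ∈ B, x + y ∉ B) :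
    sumPairs (A ∪ B) (A ∪ B) (A ∪ B) = sumPairs A A A + 3 * sumPairs B B A := by
  have h1 := sumPairs_eq_zero hA
  have h2 := sumPairs_eq_zero hB
  have h3 := sumPairs_right_comm A A B
  have h4 := sumPairs_comm A B A
  have h5 := sumPairs_right_comm B A B
  have h6 := sumPairs_comm A B B
  rw [sumPairs_union_left hAB, sumPairs_union_right _ _ hAB, sumPairs_union_right _ _ hAB,
    sumPairs_comm A (A ∪ B), sumPairs_comm A (A ∪ B), sumPairs_comm B (A ∪ B),
    sumPairs_comm B (A ∪ B), sumPairs_union_left hAB, sumPairs_union_left hAB,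
    sumPairs_union_left hAB, sumPairs_union_left hAB]
  omega

/-- Complementation inside a set closed under addition. -/
lemma sumPairs_add_sumPairs_compl {A B : Finset E} (hAB : Disjoint A B)
    (hU : ∀ x ∈ A ∪ B, ∀ y ∈ A ∪ B, x + y ∈ A ∪ B) :
    sumPairs A A A + sumPairs B B B + #A * #B = #A ^ 2 + #B ^ 2 := by
  have key {X Y : Finset E} (hX : X ⊆ A ∪ B) (hY : Y ⊆ A ∪ B) :
      sumPairs X Y A + sumPairs X Y B = #X * #Y := by
    rw [← sumPairs_union_right _ _ hAB, sumPairs_eq_mul_iff]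
    exact fun x hx y hy => hU x (hX hx) y (hY hy)
  have h1 := key (X := A) (Y := A) subset_union_left subset_union_left
  have h2 := key (X := A) (Y := B) subset_union_left subset_union_right
  have h3 := key (X := B) (Y := B) subset_union_right subset_union_right
  have h4 := sumPairs_right_comm A A B
  have h5 := sumPairs_comm A B B
  have h6 := sumPairs_right_comm B A B
  rw [pow_two, pow_two]
  omega

end Counting

section Fourier

/-- The nontrivial additive character of `ZMod 2`, with values in `ℤ`. -/
def zmodTwoSign (a : ZMod 2) : ℤ := if a = 0 then 1 else -1

lemma zmodTwoSign_add (a b : ZMod 2) :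
    zmodTwoSign (a + b) = zmodTwoSign a * zmodTwoSign b := by
  revert a b; decide

variable {E : Type*} [AddCommGroup E] [Module (ZMod 2) E]

/-- The Fourier coefficient of the indicator of `A` at `φ`. -/
def signSum (A : Finset E) (φ : Module.Dual (ZMod 2) E) : ℤ :=
  ∑ a ∈ A, zmodTwoSign (φ a)

lemma signSum_eq_card_sub (A : Finset E) (φ : Module.Dual (ZMod 2) E) :
    signSum A φ = #A - 2 * #{a ∈ A | φ a ≠ 0} := by
  have h := card_filter_add_card_filter_not (s := A) (fun a => φ a = 0)
  unfold signSum zmodTwoSign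
  rw [sum_ite, sum_const, sum_const, ← h]
  push_cast
  simp only [nsmul_eq_mul]
  ring

variable [Fintype E] [DecidableEq E] [Fintype (Module.Dual (ZMod 2) E)]

omit [DecidableEq E] in
lemma card_dual_eq : Fintype.card (Module.Dual (ZMod 2) E) = Fintype.card E := by
  rw [Module.card_eq_pow_finrank (K := ZMod 2) (V := E),
    Module.card_eq_pow_finrank (K := ZMod 2) (V := Module.Dual (ZMod 2) E),
    Subspace.dual_finrank_eq]

lemma sum_zmodTwoSign_dual (v : E) :
    ∑ φ : Module.Dual (ZMod 2) E, zmodTwoSign (φ v) = if v = 0 then (Fintype.card E : ℤ) else 0 := by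
  split_ifs with hv
  · simp [hv, zmodTwoSign, ← card_dual_eq (E := E)]
  · obtain ⟨ψ, hψ⟩ : ∃ ψ : Module.Dual (ZMod 2) E, ψ v ≠ 0 := by
      by_contra! h
      exact hv ((Module.forall_dual_apply_eq_zero_iff (ZMod 2) v).1 h)
    have h := Equiv.sum_comp (Equiv.addRight ψ) (fun φ => zmodTwoSign (φ v))
    simp only [Equiv.coe_addRight, LinearMap.add_apply, zmodTwoSign_add] at h
    rw [← sum_mul, show zmodTwoSign (ψ v) = -1 from if_neg hψ] at h
    linarith

lemma sum_signSum_sq (A : Finset E) :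
    ∑ φ, signSum A φ ^ 2 = Fintype.card E * #A := by
  simp only [signSum, pow_two, sum_mul_sum, ← zmodTwoSign_add, ← map_add]
  rw [sum_comm]
  simp_rw [sum_comm (s := univ), sum_zmodTwoSign_dual, ← ZModModule.sub_eq_add, sub_eq_zero]
  simp [mul_comm]

lemma sum_signSum_pow_three (A : Finset E) :
    ∑ φ, signSum A φ ^ 3 = Fintype.card E * sumPairs A A A := by
  have h (φ : Module.Dual (ZMod 2) E) : signSum A φ ^ 3 =
      ∑ p ∈ A ×ˢ A, ∑ z ∈ A, zmodTwoSign (φ (p.1 + p.2 + z)) := by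
    rw [pow_three', signSum, sum_mul_sum, ← sum_product', sum_mul_sum]
    simp only [zmodTwoSign_add, map_add]
  simp_rw [h]
  rw [sum_comm]
  simp_rw [sum_comm (s := univ), sum_zmodTwoSign_dual, ← ZModModule.sub_eq_add _ (_ : E), sub_eq_zero]
  simp [sumPairs, ← sum_filter, mul_comm, ZModModule.sub_eq_add]

lemma card_annihilator_mul (A : Finset E) :
    #{φ : Module.Dual (ZMod 2) E | ∀ a ∈ A, φ a = 0} *
      2 ^ Module.finrank (ZMod 2) (Submodule.span (ZMod 2) (A : Set E)) = Fintype.card E := by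
  have h : #{φ : Module.Dual (ZMod 2) E | ∀ a ∈ A, φ a = 0} =
      2 ^ Module.finrank (ZMod 2) (Submodule.span (ZMod 2) (A : Set E)).dualAnnihilator := by
    have hcard := Module.natCard_eq_pow_finrank (K := ZMod 2)
      (V := (Submodule.span (ZMod 2) (A : Set E)).dualAnnihilator)
    rw [Nat.card_zmod] at hcard
    rw [← hcard, ← Nat.subtype_card]
    simp [← SetLike.mem_coe, Submodule.coe_dualAnnihilator_span]
    exact fun φ => Iff.rfl
  rw [h, ← pow_add, add_comm, Subspace.finrank_add_finrank_dualAnnihilator_eq,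
    Module.card_eq_pow_finrank (K := ZMod 2) (V := E), ZMod.card]

/-- If every functional not vanishing on `A` has Fourier coefficient at most `δ`, then `A` has few
additive triples. -/
lemma two_pow_finrank_mul_sumPairs_le (A : Finset E) (δ : ℤ)
    (hδ : ∀ φ : Module.Dual (ZMod 2) E, (∃ a ∈ A, φ a ≠ 0) → signSum A φ ≤ δ) :
    2 ^ Module.finrank (ZMod 2) (Submodule.span (ZMod 2) (A : Set E)) * (sumPairs A A A : ℤ) ≤
      #A ^ 3 + δ * (2 ^ Module.finrank (ZMod 2) (Submodule.span (ZMod 2) (A : Set E)) * #A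
        - #A ^ 2) := by
  set D := Module.finrank (ZMod 2) (Submodule.span (ZMod 2) (A : Set E))
  set K := #{φ : Module.Dual (ZMod 2) E | ∀ a ∈ A, φ a = 0} with hK
  have hKD : (K : ℤ) * 2 ^ D = Fintype.card E := mod_cast card_annihilator_mul A
  have hKpos : (0 : ℤ) < K := by
    have : 0 < K := card_pos.2 ⟨0, by simp⟩
    exact_mod_cast this
  have hzero {φ : Module.Dual (ZMod 2) E} (hφ : ∀ a ∈ A, φ a = 0) : signSum A φ = #A := by
    simp +contextual [signSum, hφ, zmodTwoSign]
  have hpt (φ : Module.Dual (ZMod 2) E) : signSum A φ ^ 3 ≤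
      δ * signSum A φ ^ 2 + if ∀ a ∈ A, φ a = 0 then (#A : ℤ) ^ 3 - δ * #A ^ 2 else 0 := by
    split_ifs with h
    · rw [hzero h]; linarith
    · push Not at h
      nlinarith [hδ φ h, sq_nonneg (signSum A φ)]
  have hsum := sum_le_sum fun φ (_ : φ ∈ univ) => hpt φ
  rw [sum_add_distrib, ← mul_sum, sum_signSum_pow_three, sum_signSum_sq, ← sum_filter,
    sum_const, nsmul_eq_mul, ← hK, ← hKD] at hsum
  refine le_of_mul_le_mul_left ?_ hKpos
  linarith

end Fourier

section Extremal

variable {E : Type*} [AddCommGroup E] [Module (ZMod 2) E] [Fintype E] [DecidableEq E]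

omit [DecidableEq E] in
lemma card_filter_mem_submodule (W : Submodule (ZMod 2) E) [DecidablePred (· ∈ W)] :
    #{x | x ∈ W} = 2 ^ Module.finrank (ZMod 2) W := by
  have h := Module.natCard_eq_pow_finrank (K := ZMod 2) (V := W)
  rw [Nat.card_zmod] at h
  rw [← h, ← Nat.subtype_card]
  simp

omit [DecidableEq E] in
lemma card_le_two_pow_finrank_span (A : Finset E) :
    #A ≤ 2 ^ Module.finrank (ZMod 2) (Submodule.span (ZMod 2) (A : Set E)) := by
  classical
  rw [← card_filter_mem_submodule]
  exact card_le_card fun x hx => by simpa using Submodule.subset_span (mem_coe.2 hx)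

lemma sumPairs_self_le_of_finrank_eq {A : Finset E} {s t : ℕ} (hts : t ≤ 2 ^ s)
    (hA : #A = 2 ^ s + t)
    (hr : Module.finrank (ZMod 2) (Submodule.span (ZMod 2) (A : Set E)) = s + 1) :
    sumPairs A A A ≤ (2 ^ s) ^ 2 + 3 * t ^ 2 := by
  classical
  set W := Submodule.span (ZMod 2) (A : Set E)
  have hAW : A ⊆ ({x | x ∈ W} : Finset E) :=
    fun x hx => by simpa using Submodule.subset_span (mem_coe.2 hx)
  have hcard := card_sdiff_add_card_eq_card hAW
  rw [card_filter_mem_submodule, hr, pow_succ, hA] at hcard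
  have key := sumPairs_add_sumPairs_compl (A := A) (B := ({x | x ∈ W} : Finset E) \ A)
    disjoint_sdiff (by
      rw [union_sdiff_of_subset hAW]
      simpa using fun x hx y hy => W.add_mem hx hy)
  have hB : #(({x | x ∈ W} : Finset E) \ A) = 2 ^ s - t := by omega
  rw [hA, hB] at key
  zify [hts] at key ⊢
  nlinarith

lemma sumPairs_self_lt_of_balanced {A : Finset E} {p t : ℕ} (ht : 0 < t)
    (hA : #A = 2 * p + t)
    (hr : 2 * (2 * p + t) ≤
      2 ^ Module.finrank (ZMod 2) (Submodule.span (ZMod 2) (A : Set E)))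
    (hbal : ∀ φ : Module.Dual (ZMod 2) E, (∃ a ∈ A, φ a ≠ 0) →
      p < #{a ∈ A | φ a ≠ 0} ∧ t < #{a ∈ A | φ a ≠ 0}) :
    sumPairs A A A < (2 * p) ^ 2 + 3 * t ^ 2 := by
  have : Finite (Module.Dual (ZMod 2) E) := Module.finite_of_finite (ZMod 2)
  have := Fintype.ofFinite (Module.Dual (ZMod 2) E)
  set D : ℕ := 2 ^ Module.finrank (ZMod 2) (Submodule.span (ZMod 2) (A : Set E)) with hD
  have hbound := two_pow_finrank_mul_sumPairs_le A (#A - 2 * (max p t + 1)) fun φ hφ => by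
    have := hbal φ hφ
    rw [signSum_eq_card_sub]
    omega
  have hD' : (2 : ℤ) ^ Module.finrank (ZMod 2) (Submodule.span (ZMod 2) (A : Set E)) = D := by
    simp [hD]
  rw [hD', hA] at hbound
  have hDpos : (0 : ℤ) < D := by
    have : 0 < D := by omega
    exact_mod_cast this
  zify at hr ht ⊢
  set n : ℤ := 2 * p + t with hn
  push_cast at hbound
  rw [← hn] at hbound
  have hmax : (0 : ℤ) ≤ max (p : ℤ) t := by positivity
  have hnpos : (0 : ℤ) < n := by positivity
  have h2 : D * (sumPairs A A A : ℤ) ≤ D * (n * (n - (max (p : ℤ) t + 1))) := by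
    nlinarith [mul_le_mul_of_nonneg_left hr (show 0 ≤ n * (max (p : ℤ) t + 1) by positivity)]
  have h3 := le_of_mul_le_mul_left h2 hDpos
  have hp : (0 : ℤ) ≤ p := by positivity
  rcases le_total (p : ℤ) t with h | h
  · rw [max_eq_right h] at h3
    nlinarith
  · rw [max_eq_left h] at h3
    nlinarith [sq_nonneg ((p : ℤ) - t), sq_nonneg (p : ℤ)]

omit [Fintype E] in
/-- If all sums of two elements of `B` lie in `A`, then adjoining `B` to `A` raises the rank by at
most one. -/
lemma finrank_span_le_of_sumPairs_eq {A B : Finset E} (hB : B.Nonempty)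
    (h : sumPairs B B A = #B ^ 2) :
    Module.finrank (ZMod 2) (Submodule.span (ZMod 2) ((A ∪ B : Finset E) : Set E)) ≤
      Module.finrank (ZMod 2) (Submodule.span (ZMod 2) (A : Set E)) + 1 := by
  obtain ⟨b, hb⟩ := hB
  rw [pow_two, sumPairs_eq_mul_iff] at h
  have hle : Submodule.span (ZMod 2) ((A ∪ B : Finset E) : Set E) ≤
      Submodule.span (ZMod 2) (A : Set E) ⊔ Submodule.span (ZMod 2) {b} := by
    rw [Submodule.span_le]
    intro x hx
    rcases mem_union.1 (mem_coe.1 hx) with hx | hx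
    · exact Submodule.mem_sup_left (Submodule.subset_span hx)
    · have hxb : x = (x + b) + b := by rw [add_assoc, ZModModule.add_self, add_zero]
      rw [hxb]
      exact Submodule.add_mem_sup (Submodule.subset_span (h x hx b hb))
        (Submodule.mem_span_singleton_self b)
  calc _ ≤ _ := Submodule.finrank_mono hle
    _ ≤ _ := Submodule.finrank_add_le_finrank_add_finrank _ _
    _ ≤ _ := Nat.add_le_add_left (finrank_span_le_card ({b} : Set E) |>.trans (by simp)) _

omit [Fintype E] in
lemma finrank_span_lt_card {A : Finset E} (h0 : 0 ∈ A) :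
    Module.finrank (ZMod 2) (Submodule.span (ZMod 2) (A : Set E)) < #A := by
  rw [← Submodule.span_sdiff_singleton_zero, ← coe_erase]
  exact (finrank_span_finset_le_card _).trans_lt (card_erase_lt_of_mem h0)

/-- A set `A` of `2 ^ s + t` vectors containing `0`, where `0 < t ≤ 2 ^ s`, has at most
`(2 ^ s) ^ 2 + 3 * t ^ 2` pairs whose sum lies in `A`, and a set attaining this bound has rank at most `s + 1`. -/
theorem sumPairs_self_le (n : ℕ) : ∀ (A : Finset E) (s t : ℕ), #A = n → 0 ∈ A → 0 < t →
    t ≤ 2 ^ s → #A = 2 ^ s + t → sumPairs A A A ≤ (2 ^ s) ^ 2 + 3 * t ^ 2 ∧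
      (sumPairs A A A = (2 ^ s) ^ 2 + 3 * t ^ 2 →
        Module.finrank (ZMod 2) (Submodule.span (ZMod 2) (A : Set E)) ≤ s + 1) := by
  induction n using Nat.strong_induction_on with
  | _ n ih =>
  intro A s t hn h0 ht hts hA
  have hlow := card_le_two_pow_finrank_span A
  have hupp := finrank_span_lt_card h0
  set r := Module.finrank (ZMod 2) (Submodule.span (ZMod 2) (A : Set E)) with hr
  have hsr : s < r := (Nat.pow_lt_pow_iff_right (one_lt_two)).1 (by omega : 2 ^ s < 2 ^ r)
  by_cases hrs : r ≤ s + 1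
  · exact ⟨sumPairs_self_le_of_finrank_eq hts hA (by omega), fun _ => hrs⟩
  obtain _ | s := s
  · simp at hts hA; omega
  set p := 2 ^ s with hp
  have hp2 : 2 ^ (s + 1) = 2 * p := by rw [pow_succ, mul_comm]
  have hppos : 0 < p := by positivity
  rw [hp2] at hts hA ⊢
  by_cases hbal : ∀ φ : Module.Dual (ZMod 2) E, (∃ a ∈ A, φ a ≠ 0) →
      p < #{a ∈ A | φ a ≠ 0} ∧ t < #{a ∈ A | φ a ≠ 0}
  · have hpow : 2 ^ (s + 1 + 2) ≤ 2 ^ r := Nat.pow_le_pow_right (by norm_num) (by omega)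
    rw [pow_add, hp2] at hpow
    have h := sumPairs_self_lt_of_balanced ht hA (by rw [← hr]; omega) hbal
    exact ⟨h.le, fun h' => absurd h' h.ne⟩
  push Not at hbal
  obtain ⟨φ, ⟨a, haA, haφ⟩, hφ⟩ := hbal
  have hunion : ({a ∈ A | φ a = 0} ∪ {a ∈ A | φ a ≠ 0} : Finset E) = A :=
    filter_union_filter_not_eq _ _
  have hcard := card_filter_add_card_filter_not (s := A) (fun a => φ a = 0)
  have hB : ({a ∈ A | φ a ≠ 0} : Finset E).Nonempty := ⟨a, by simp [haA, haφ]⟩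
  have hsplit := sumPairs_union_self (A := {a ∈ A | φ a = 0}) (B := {a ∈ A | φ a ≠ 0})
    (disjoint_filter_filter_not _ _ _)
    (by simp +contextual) (by
      have h2 : ∀ x y : ZMod 2, x ≠ 0 → y ≠ 0 → x + y = 0 := by decide
      simp only [mem_filter, map_add]
      rintro x ⟨-, hx⟩ y ⟨-, hy⟩ ⟨-, h⟩
      exact h (h2 _ _ hx hy))
  have h00 : (0 : E) ∈ ({a ∈ A | φ a = 0} : Finset E) := by simp [h0]
  have hrank := finrank_span_le_of_sumPairs_eq (A := {a ∈ A | φ a = 0}) hB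
  rw [hunion] at hsplit hrank
  have hle := sumPairs_le {a ∈ A | φ a ≠ 0} {a ∈ A | φ a ≠ 0} {a ∈ A | φ a = 0}
  have hBpos := hB.card_pos
  change #{a ∈ A | φ a = 0} + #{a ∈ A | φ a ≠ 0} = #A at hcard
  generalize ({a ∈ A | φ a = 0} : Finset E) = A₀ at *
  generalize ({a ∈ A | φ a ≠ 0} : Finset E) = A₁ at *
  rw [← pow_two] at hle
  rcases lt_trichotomy #A₁ t with hlt | heq | hgt
  · obtain ⟨hb, -⟩ := ih #A₀ (by omega) A₀ (s + 1) (t - #A₁) rfl h00 (by omega) (by omega) (by omega)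
    have hstrict : sumPairs A A A < (2 * p) ^ 2 + 3 * t ^ 2 := by
      rw [hp2] at hb
      obtain ⟨c, rfl⟩ := Nat.exists_eq_add_of_lt hlt
      rw [show #A₁ + c + 1 - #A₁ = c + 1 by omega] at hb
      nlinarith
    exact ⟨hstrict.le, fun h => absurd h hstrict.ne⟩
  · obtain ⟨hb, hb'⟩ := ih #A₀ (by omega) A₀ s p rfl h00 (by omega) (by omega) (by omega)
    rw [← hp] at hb hb'
    rw [heq] at hle hrank
    refine ⟨by linarith, fun h => ?_⟩
    have := hrank (by linarith)
    have := hb' (by linarith)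
    omega
  · have hle_p : #A₁ ≤ p := by
      by_contra! h
      exact absurd (hφ h) (by omega)
    obtain ⟨hb, hb'⟩ := ih #A₀ (by omega) A₀ s (p + t - #A₁) rfl h00 (by omega) (by omega) (by omega)
    rw [← hp] at hb hb'
    obtain ⟨u, hu⟩ := Nat.exists_eq_add_of_lt hgt
    obtain ⟨v, hv⟩ := Nat.exists_eq_add_of_le hle_p
    rw [show p + t - #A₁ = t + v by omega] at hb hb'
    have hexp : p ^ 2 + t ^ 2 = #A₁ ^ 2 + (t + v) ^ 2 + 2 * v * (u + 1) := by
      rw [hv, hu]; ring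
    have hnn : 0 ≤ v * (u + 1) := by positivity
    refine ⟨by linarith, fun h => ?_⟩
    have := hrank (by linarith)
    have := hb' (by linarith)
    omega

/-- The bound `sumPairs_self_le` is attained as soon as the space is large enough. -/
lemma exists_sumPairs_self_eq {s t : ℕ} (hs : s < Module.finrank (ZMod 2) E) (hts : t ≤ 2 ^ s) :
    ∃ A : Finset E, 0 ∈ A ∧ #A = 2 ^ s + t ∧ sumPairs A A A = (2 ^ s) ^ 2 + 3 * t ^ 2 := by
  classical
  obtain ⟨b, hbs, hb⟩ := exists_finset_linearIndependent_of_le_finrank hs.le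
  set W := Submodule.span (ZMod 2) (b : Set E)
  have hW : Module.finrank (ZMod 2) W = s := by rw [finrank_span_finset_eq_card hb, hbs]
  obtain ⟨u, hu⟩ : ∃ u, u ∉ W := by
    by_contra! h
    rw [(Submodule.eq_top_iff' (p := W)).2 h, finrank_top] at hW
    omega
  have hcard := card_filter_mem_submodule W
  rw [hW] at hcard
  obtain ⟨T, hTW, hT⟩ := exists_subset_card_eq (hts.trans_eq hcard.symm)
  set C := T.image (u + ·)
  have hC : ∀ x ∈ C, u + x ∈ W := by
    intro x hx
    obtain ⟨y, hy, rfl⟩ := mem_image.1 hx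
    rw [← add_assoc, ZModModule.add_self, zero_add]
    simpa using hTW hy
  have hCW : ∀ x ∈ C, x ∉ W := fun x hx hxW => hu <| by
    simpa using W.sub_mem (hC x hx) hxW
  have hCC : ∀ x ∈ C, ∀ y ∈ C, x + y ∈ W := fun x hx y hy => by
    have h := W.add_mem (hC x hx) (hC y hy)
    rwa [add_add_add_comm, ZModModule.add_self, zero_add] at h
  have hCcard : #C = t := by rw [card_image_of_injective _ (add_right_injective u), hT]
  have hdisj : Disjoint ({x | x ∈ W} : Finset E) C :=
    disjoint_left.2 fun x hx hxC => hCW x hxC (by simpa using hx)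
  refine ⟨({x | x ∈ W} : Finset E) ∪ C, by simp, by rw [card_union_of_disjoint hdisj, hcard, hCcard], ?_⟩
  rw [sumPairs_union_self hdisj, sumPairs_eq_mul_iff.2, sumPairs_eq_mul_iff.2, hcard, hCcard]
  · ring
  · simpa using hCC
  · simpa using fun x hx y hy => W.add_mem hx hy
  · simp only [mem_filter, mem_univ, true_and]
    exact fun x hx y hy h => hCW _ h (W.add_mem hx hy)
  · exact fun x hx y hy h => hCW _ h (hCC x hx y hy)

end Extremal

section WordCount

lemma zero_notMem_of_subset_Hm {m : ℕ} {d : Finset (V m)} (hd : d ⊆ Hm m) : (0 : V m) ∉ d := by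
  intro h
  simpa [Hm] using hd h

lemma wordCount_eq_of_lt_three {m : ℕ} {d : Finset (V m)} (hd : d ⊆ Hm m) {t : ℕ} (ht : t < 3) :
    wordCount m d t = if t = 0 then 1 else 0 := by
  have h0 : (0 : V m) ∉ d := zero_notMem_of_subset_Hm hd
  unfold wordCount sumCount
  interval_cases t
  · simp [filter_singleton]
  · simp only [one_ne_zero, if_false, card_eq_zero, filter_eq_empty_iff, mem_powersetCard,
      card_eq_one]
    rintro _ ⟨hS, a, rfl⟩ h
    simp only [sum_singleton, id] at h
    exact h0 (h ▸ hS (mem_singleton_self a))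
  · simp only [OfNat.ofNat_ne_zero, if_false, card_eq_zero, filter_eq_empty_iff, mem_powersetCard,
      card_eq_two]
    rintro _ ⟨hS, a, b, hab, rfl⟩ h
    rw [sum_pair hab, id, id, ← ZModModule.sub_eq_add, sub_eq_zero] at h
    exact hab h

lemma sumPairs_self_eq_six_mul_wordCount {m : ℕ} {d : Finset (V m)} (hd : d ⊆ Hm m) :
    sumPairs d d d = 6 * wordCount m d 3 := by
  have h0 : (0 : V m) ∉ d := zero_notMem_of_subset_Hm hd
  unfold sumPairs wordCount sumCount
  rw [mul_comm, card_eq_sum_card_fiberwise (f := fun p : V m × V m => {p.1, p.2, p.1 + p.2})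
    (t := (d.powersetCard 3).filter (fun S => S.sum id = 0))]
  · refine sum_const_nat fun S hS => ?_
    simp only [mem_filter, mem_powersetCard] at hS
    obtain ⟨⟨hSd, hS3⟩, hsum⟩ := hS
    have hfib : {p ∈ {p ∈ d ×ˢ d | p.1 + p.2 ∈ d} |
        ({p.1, p.2, p.1 + p.2} : Finset (V m)) = S} = S.offDiag := by
      ext ⟨x, y⟩
      simp only [mem_filter, mem_product, mem_offDiag]
      constructor
      · rintro ⟨⟨⟨hx, hy⟩, hxy⟩, rfl⟩
        refine ⟨by simp, by simp, ?_⟩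
        rintro rfl
        exact h0 (ZModModule.add_self x ▸ hxy)
      · rintro ⟨hx, hy, hne⟩
        obtain ⟨z, hz⟩ : ∃ z, S \ {x, y} = {z} := by
          rw [← card_eq_one, card_sdiff_of_subset (by grind), hS3, card_pair hne]
        have hS : S = {x, y, z} := by grind
        have hzx : z ≠ x ∧ z ≠ y := by grind
        rw [hS, sum_insert (by grind), sum_pair hzx.2.symm, id, id, id, ← add_assoc,
          ← ZModModule.sub_eq_add _ z, sub_eq_zero] at hsum
        rw [hsum]
        exact ⟨⟨⟨hSd hx, hSd hy⟩, hSd (by rw [hS]; simp)⟩, hS.symm⟩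
    rw [hfib, offDiag_card, hS3]
  · rintro ⟨x, y⟩ hp
    simp only [coe_filter, mem_product, Set.mem_ofPred_eq, mem_powersetCard] at hp ⊢
    obtain ⟨⟨hx, hy⟩, hxy⟩ := hp
    have hne : x ≠ y := by
      rintro rfl
      exact h0 (ZModModule.add_self x ▸ hxy)
    have hx0 : x ≠ 0 := fun h => h0 (h ▸ hx)
    have hy0 : y ≠ 0 := fun h => h0 (h ▸ hy)
    have hxy1 : x ≠ x + y := by simpa using hy0
    have hxy2 : y ≠ x + y := by simpa using hx0
    refine ⟨⟨by grind, card_eq_three.2 ⟨_, _, _, hne, hxy1, hxy2, rfl⟩⟩, ?_⟩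
    rw [sum_insert (by grind), sum_pair hxy2, id, id, id, ← add_assoc, ZModModule.add_self]

lemma Hm_sdiff_eq {m : ℕ} (d : Finset (V m)) : Hm m \ d = dᶜ.erase 0 := by
  ext x
  simp [Hm]

lemma wordCount_three_le_of_isMA {m : ℕ} {d d' : Finset (V m)} (hMA : IsMA m d)
    (hd' : d' ⊆ Hm m) (hcard : #d' = #d) : wordCount m d 3 ≤ wordCount m d' 3 := by
  by_contra! h
  refine hMA.2 d' hd' hcard ⟨3, by norm_num, h, fun t ht => ?_⟩
  rw [wordCount_eq_of_lt_three hd' ht, wordCount_eq_of_lt_three hMA.1 ht]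

end WordCount

/-- If `d ⊆ H_m` is a minimum aberration design, then its complement
`d̄ = H_m \ d` has minimum rank among subsets of `H_m` of cardinality `h = 2^m - 1 - k`. -/
theorem complement_of_MA_has_minimum_rank (m : ℕ) (hm : 2 ≤ m)
    (d : Finset (V m)) (hd : d ⊆ Hm m) (hMA : IsMA m d) :
    ∀ f ⊆ Hm m, f.card = (Hm m \ d).card → rankOf m (Hm m \ d) ≤ rankOf m f := by
  intro f hf hfcard
  have h0d := zero_notMem_of_subset_Hm hd
  have h0f := zero_notMem_of_subset_Hm hf
  unfold rankOf
  rw [Hm_sdiff_eq, coe_erase, Submodule.span_sdiff_singleton_zero]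
  have h0 : (0 : V m) ∈ dᶜ := by simpa using h0d
  have hn : #dᶜ = #f + 1 := by rw [hfcard, Hm_sdiff_eq, card_erase_add_one h0]
  have hfrank : #f + 1 ≤
      2 ^ Module.finrank (ZMod 2) (Submodule.span (ZMod 2) (f : Set (V m))) := by
    have h := card_le_two_pow_finrank_span (insert 0 f)
    rwa [card_insert_of_notMem h0f, coe_insert, Submodule.span_insert_zero] at h
  rcases Nat.eq_zero_or_pos #f with hf0 | hfpos
  · have := finrank_span_lt_card h0
    omega
  set s := Nat.log 2 #f
  have hs1 : 2 ^ s ≤ #f := Nat.pow_log_le_self 2 hfpos.ne'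
  have hs2 : #f < 2 ^ (s + 1) := Nat.lt_pow_succ_log_self one_lt_two _
  rw [pow_succ] at hs2
  obtain ⟨t, ht⟩ := Nat.exists_eq_add_of_le hs1
  have hsf : s < Module.finrank (ZMod 2) (Submodule.span (ZMod 2) (f : Set (V m))) :=
    (Nat.pow_lt_pow_iff_right one_lt_two).1 (by omega)
  obtain ⟨A, h0A, hAcard, hA⟩ := exists_sumPairs_self_eq (E := V m) (s := s) (t := t + 1)
    (hsf.trans_le (Submodule.finrank_le _)) (by omega)
  have hcompl (B : Finset (V m)) :=
    sumPairs_add_sumPairs_compl (disjoint_compl_right : Disjoint B Bᶜ) (by simp)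
  have hcard : #Aᶜ = #d := by
    have h1 := card_add_card_compl A
    have h2 := card_add_card_compl d
    omega
  have hAHm : Aᶜ ⊆ Hm m := by
    intro x hx
    simp only [Hm, mem_filter, mem_univ, true_and]
    rintro rfl
    exact mem_compl.1 hx h0A
  have hword := wordCount_three_le_of_isMA hMA hAHm hcard
  have hd1 := hcompl d
  have hA1 := hcompl Aᶜ
  have hAd : #A = #dᶜ := by omega
  rw [compl_compl, hcard, hAd] at hA1
  rw [sumPairs_self_eq_six_mul_wordCount hd] at hd1
  rw [sumPairs_self_eq_six_mul_wordCount hAHm] at hA1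
  obtain ⟨hle, heq⟩ := sumPairs_self_le _ dᶜ s (t + 1) rfl h0 (by omega) (by omega) (by omega)
  exact (heq (by omega)).trans hsf
end

section
/- For every subset d̄ ⊆ H_m with |d̄| = h, the number of 3-element subsets T of H_m whose elements sum to 0 in V and which satisfy T ∩ d̄ ≠ ∅ equals h·(2^m − h − 1)/2 + a_3(d̄). -/
open Finset Polynomial

theorem add_add_eq_zero_iff_eq_add {m : ℕ} (x y z : V m) : x + y + z = 0 ↔ z = x + y := by
  have key : ∀ a b c : ZMod 2, a + b + c = 0 ↔ c = a + b := by decide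
  simp only [funext_iff, Pi.add_apply, Pi.zero_apply, key]

/-- Two distinct elements of a zero-sum triple determine the third one. -/
theorem eq_insert_insert_add_of_sum_eq_zero {m : ℕ} {T : Finset (V m)} (hT : T.card = 3)
    (hsum : T.sum id = 0) {x y : V m} (hx : x ∈ T) (hy : y ∈ T) (hxy : x ≠ y) :
    T = {x, y, x + y} := by
  have hy' : y ∈ T.erase x := mem_erase.2 ⟨hxy.symm, hy⟩
  have hcard : ((T.erase x).erase y).card = 1 := by
    rw [card_erase_of_mem hy', card_erase_of_mem hx, hT]
  obtain ⟨z, hz⟩ := card_eq_one.1 hcard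
  have hsum' : x + y + z = 0 := by
    rw [← hsum, ← add_sum_erase T id hx, ← add_sum_erase _ id hy', hz]
    simp [add_assoc]
  rw [← (add_add_eq_zero_iff_eq_add x y z).1 hsum', ← hz, insert_erase hy', insert_erase hx]

theorem card_insert_insert_add {m : ℕ} {x y : V m} (hx : x ≠ 0) (hy : y ≠ 0) (hxy : x ≠ y) :
    ({x, y, x + y} : Finset (V m)).card = 3 :=
  card_eq_three.2 ⟨x, y, x + y, hxy, by simpa using hy, by simpa using hx, rfl⟩

theorem sum_insert_insert_add {m : ℕ} {x y : V m} (hx : x ≠ 0) (hy : y ≠ 0) (hxy : x ≠ y) :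
    ({x, y, x + y} : Finset (V m)).sum id = 0 := by
  rw [sum_insert (by simp [hxy, hy]), sum_insert (by simp [hx])]
  simpa [add_assoc] using (add_add_eq_zero_iff_eq_add x y (x + y)).2 rfl

theorem zero_notMem_Hm (m : ℕ) : (0 : V m) ∉ Hm m := by simp [Hm]

theorem card_Hm (m : ℕ) : (Hm m).card = 2 ^ m - 1 := by
  rw [Hm, filter_ne', card_erase_of_mem (mem_univ _), card_univ]
  simp [ZMod.card]

/-- The zero-sum triples of `Hm m` that meet both `d` and its complement. -/
def mixedTriples (m : ℕ) (d : Finset (V m)) : Finset (Finset (V m)) :=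
  ((Hm m).powersetCard 3).filter
    (fun T => T.sum id = 0 ∧ (T ∩ d).Nonempty ∧ (T \ d).Nonempty)

theorem insert_insert_add_mem_mixedTriples {m : ℕ} {d : Finset (V m)} (hd : d ⊆ Hm m)
    {x y : V m} (hx : x ∈ d) (hy : y ∈ Hm m \ d) : {x, y, x + y} ∈ mixedTriples m d := by
  obtain ⟨hyH, hyd⟩ := mem_sdiff.1 hy
  have hx0 : x ≠ 0 := fun h => zero_notMem_Hm m (h ▸ hd hx)
  have hy0 : y ≠ 0 := fun h => zero_notMem_Hm m (h ▸ hyH)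
  have hxy : x ≠ y := fun h => hyd (h ▸ hx)
  refine mem_filter.2 ⟨mem_powersetCard.2 ⟨?_, card_insert_insert_add hx0 hy0 hxy⟩,
    sum_insert_insert_add hx0 hy0 hxy, ⟨x, by simp [hx]⟩, ⟨y, by simp [hyd]⟩⟩
  have hadd : x + y ∈ Hm m := by
    refine mem_filter.2 ⟨mem_univ _, fun h => hxy ?_⟩
    simpa using ((add_add_eq_zero_iff_eq_add x 0 y).1 (by simpa using h)).symm
  simp [insert_subset_iff, hd hx, hyH, hadd]

theorem card_filter_insert_insert_add_eq {m : ℕ} {d T : Finset (V m)}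
    (hT : T ∈ mixedTriples m d) :
    ((d ×ˢ (Hm m \ d)).filter (fun p => {p.1, p.2, p.1 + p.2} = T)).card = 2 := by
  obtain ⟨hT3, hsum, hin, hout⟩ := mem_filter.1 hT
  obtain ⟨hTH, hT3⟩ := mem_powersetCard.1 hT3
  have hfiber : (d ×ˢ (Hm m \ d)).filter (fun p => {p.1, p.2, p.1 + p.2} = T) =
      (T ∩ d) ×ˢ (T \ d) := by
    ext ⟨x, y⟩
    simp only [mem_filter, mem_product, mem_sdiff, mem_inter]
    constructor
    · rintro ⟨⟨hx, -, hy⟩, rfl⟩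
      simp [hx, hy]
    · rintro ⟨⟨hxT, hx⟩, hyT, hy⟩
      exact ⟨⟨hx, hTH hyT, hy⟩, (eq_insert_insert_add_of_sum_eq_zero hT3 hsum hxT hyT
        (fun h => hy (h ▸ hx))).symm⟩
  have hadd := card_inter_add_card_sdiff T d
  rw [hT3] at hadd
  have hin := hin.card_pos
  have hout := hout.card_pos
  rw [hfiber, card_product]
  obtain ⟨h₁, h₂⟩ | ⟨h₁, h₂⟩ : (T ∩ d).card = 1 ∧ (T \ d).card = 2 ∨
      (T ∩ d).card = 2 ∧ (T \ d).card = 1 := by omega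
  all_goals rw [h₁, h₂]

theorem card_mixedTriples_mul_two {m : ℕ} {d : Finset (V m)} (hd : d ⊆ Hm m) :
    (mixedTriples m d).card * 2 = d.card * (2 ^ m - d.card - 1) := by
  have hmaps : ∀ p ∈ d ×ˢ (Hm m \ d),
      ({p.1, p.2, p.1 + p.2} : Finset (V m)) ∈ mixedTriples m d := fun p hp =>
    insert_insert_add_mem_mixedTriples hd (mem_product.1 hp).1 (mem_product.1 hp).2
  have hfib := card_eq_sum_card_fiberwise hmaps
  rw [sum_congr rfl (fun T hT => card_filter_insert_insert_add_eq hT), sum_const, smul_eq_mul,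
    card_product, card_sdiff_of_subset hd, card_Hm, Nat.sub_right_comm] at hfib
  exact hfib.symm

/-- For a subset `d̄ ⊆ H_m` with `h` elements, the number of zero-sum
`3`-element subsets of `H_m` meeting `d̄` equals `h(2^m - h - 1)/2 + a₃(d̄)`. -/
theorem count_zero_sum_triples_meeting_complement (m : ℕ) (hm : 2 ≤ m)
    (dbar : Finset (V m)) (hsub : dbar ⊆ Hm m) (h : ℕ) (hcard : dbar.card = h) :
    (((Hm m).powersetCard 3).filter
        (fun T => T.sum id = 0 ∧ (T ∩ dbar).Nonempty)).card =
      h * (2 ^ m - h - 1) / 2 + wordCount m dbar 3 := by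
  subst hcard
  have hdisj : Disjoint (mixedTriples m dbar)
      ((dbar.powersetCard 3).filter (fun S => S.sum id = 0)) := by
    refine disjoint_left.2 fun T hT hT' => ?_
    obtain ⟨-, -, -, hout⟩ := mem_filter.1 hT
    exact hout.ne_empty (sdiff_eq_empty_iff_subset.2
      (mem_powersetCard.1 (mem_filter.1 hT').1).1)
  have hunion : ((Hm m).powersetCard 3).filter
        (fun T => T.sum id = 0 ∧ (T ∩ dbar).Nonempty) =
      mixedTriples m dbar ∪ (dbar.powersetCard 3).filter (fun S => S.sum id = 0) := by
    ext T
    simp only [mixedTriples, mem_union, mem_filter, mem_powersetCard, sdiff_nonempty]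
    constructor
    · rintro ⟨⟨hTH, hT3⟩, hsum, hin⟩
      by_cases hT : T ⊆ dbar
      · exact Or.inr ⟨⟨hT, hT3⟩, hsum⟩
      · exact Or.inl ⟨⟨hTH, hT3⟩, hsum, hin, hT⟩
    · rintro (⟨hT, hsum, hin, -⟩ | ⟨⟨hT, hT3⟩, hsum⟩)
      · exact ⟨hT, hsum, hin⟩
      · refine ⟨⟨hT.trans hsub, hT3⟩, hsum, ?_⟩
        rw [inter_eq_left.2 hT, ← card_pos, hT3]
        norm_num
  rw [hunion, card_union_of_disjoint hdisj, ← card_mixedTriples_mul_two hsub,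
    Nat.mul_div_cancel _ two_pos]
  rfl
end

section
/- For every design d ⊆ H_m with complement d̄ = H_m \ d of cardinality h, one has a_3(d) + a_3(d̄) = (2^m − 1)(2^m − 2)/6 − h·(2^m − h − 1)/2. In particular, minimizing a_3(d) over designs of fixed cardinality k = 2^m − 1 − h is equivalent to maximizing a_3(d̄) over h-element subsets. -/
open Finset Polynomial

/-- The 3-element subsets of `A` summing to zero. -/
def triples (m : ℕ) (A : Finset (V m)) : Finset (Finset (V m)) :=
  (A.powersetCard 3).filter (fun S => S.sum id = 0)

theorem mem_triples {m : ℕ} {A S : Finset (V m)} :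
    S ∈ triples m A ↔ (S ⊆ A ∧ S.card = 3) ∧ S.sum id = 0 := by
  simp [triples, mem_powersetCard]

theorem card_triples (m : ℕ) (A : Finset (V m)) : (triples m A).card = wordCount m A 3 := rfl

theorem add_self_V {m : ℕ} (x : V m) : x + x = 0 := by
  ext i
  exact CharTwo.add_self_eq_zero (x i)

theorem mem_Hm {m : ℕ} {x : V m} : x ∈ Hm m ↔ x ≠ 0 := by simp [Hm]

theorem add_eq_zero_V {m : ℕ} {x y : V m} : x + y = 0 ↔ x = y := by
  refine ⟨fun h => ?_, fun h => h ▸ add_self_V x⟩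
  have := congrArg (· + y) h
  simpa [add_assoc, add_self_V] using this

/-- The sum-zero triple through two distinct nonzero vectors. -/
theorem insert_pair_mem_triples {m : ℕ} {x y : V m} (hx : x ≠ 0) (hy : y ≠ 0) (hxy : x ≠ y) :
    ({x, y, x + y} : Finset (V m)) ∈ triples m (Hm m) := by
  have h1 : x ≠ x + y := by simpa using hy
  have h2 : y ≠ x + y := by simpa using hx
  refine mem_triples.2 ⟨⟨?_, card_eq_three.2 ⟨x, y, x + y, hxy, h1, h2, rfl⟩⟩, ?_⟩
  · intro z hz
    simp only [mem_insert, mem_singleton] at hz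
    rw [mem_Hm]
    rcases hz with rfl | rfl | rfl
    · exact hx
    · exact hy
    · exact fun h => hxy (add_eq_zero_V.1 h)
  · rw [sum_insert (by simp [hxy, hy]), sum_insert (by simp [hx]), sum_singleton]
    simp only [id]
    rw [← add_assoc, add_self_V]

theorem eq_insert_pair_iff {m : ℕ} {S : Finset (V m)} (hS : S ∈ triples m (Hm m))
    {x y : V m} (hxy : x ≠ y) :
    ({x, y, x + y} : Finset (V m)) = S ↔ x ∈ S ∧ y ∈ S := by
  refine ⟨fun h => by simp [← h], fun ⟨hx, hy⟩ => ?_⟩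
  obtain ⟨⟨-, hc⟩, hs⟩ := mem_triples.1 hS
  refine eq_of_subset_of_card_le ?_ ?_
  · have hsub : ({x, y} : Finset (V m)) ⊆ S := by
      intro z hz
      simp only [mem_insert, mem_singleton] at hz
      rcases hz with rfl | rfl <;> assumption
    have hcard : (S \ {x, y}).card = 1 := by
      rw [card_sdiff_of_subset hsub, hc, card_pair hxy]
    obtain ⟨z, hz⟩ := card_eq_one.1 hcard
    have hsum := sum_sdiff (f := id) hsub
    rw [hz, hs, sum_singleton, sum_pair hxy] at hsum
    have hzS : z ∈ S := (mem_sdiff.1 (hz ▸ mem_singleton_self z)).1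
    have hz' : z = x + y := add_eq_zero_V.1 hsum
    intro w hw
    simp only [mem_insert, mem_singleton] at hw
    rcases hw with rfl | rfl | rfl
    · exact hx
    · exact hy
    · exact hz' ▸ hzS
  · obtain ⟨⟨hH, -⟩, -⟩ := mem_triples.1 hS
    have := (mem_triples.1 (insert_pair_mem_triples (mem_Hm.1 (hH hx))
      (mem_Hm.1 (hH hy)) hxy)).1.2
    rw [this, hc]

/-- A set of pairs of distinct nonzero vectors is partitioned by the sum-zero triples. -/
theorem card_eq_sum_triples {m : ℕ} {P : Finset (V m × V m)} (hP : P ⊆ (Hm m).offDiag) :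
    P.card = ∑ S ∈ triples m (Hm m), (P.filter (fun p => p.1 ∈ S ∧ p.2 ∈ S)).card := by
  rw [card_eq_sum_card_fiberwise (f := fun p : V m × V m => ({p.1, p.2, p.1 + p.2} : Finset (V m)))
    (t := triples m (Hm m))]
  · refine sum_congr rfl fun S hS => congrArg card (filter_congr fun p hp => ?_)
    exact eq_insert_pair_iff hS (mem_offDiag.1 (hP hp)).2.2
  · intro p hp
    obtain ⟨h1, h2, h3⟩ := mem_offDiag.1 (hP hp)
    exact insert_pair_mem_triples (mem_Hm.1 h1) (mem_Hm.1 h2) h3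

theorem six_mul_wordCount_Hm (m : ℕ) :
    6 * wordCount m (Hm m) 3 = (2 ^ m - 1) * (2 ^ m - 2) := by
  have h := card_eq_sum_triples (Subset.refl (Hm m).offDiag)
  rw [sum_congr rfl (g := fun _ => 6), sum_const, card_triples, offDiag_card, card_Hm] at h
  · rw [show 2 ^ m - 2 = 2 ^ m - 1 - 1 by omega, Nat.mul_sub_one, h, smul_eq_mul, mul_comm]
  · intro S hS
    obtain ⟨⟨hH, hc⟩, -⟩ := mem_triples.1 hS
    have : (Hm m).offDiag.filter (fun p => p.1 ∈ S ∧ p.2 ∈ S) = S.offDiag := by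
      ext p
      simp only [mem_filter, mem_offDiag]
      exact ⟨fun h => ⟨h.2.1, h.2.2, h.1.2.2⟩, fun h => ⟨⟨hH h.1, hH h.2.1, h.2.2⟩, h.1, h.2.1⟩⟩
    rw [this, offDiag_card, hc]

theorem filter_triples_subset {m : ℕ} {d : Finset (V m)} (hd : d ⊆ Hm m) :
    (triples m (Hm m)).filter (fun S => S ⊆ d) = triples m d := by
  ext S
  simp only [mem_filter, mem_triples]
  exact ⟨fun h => ⟨⟨h.2, h.1.1.2⟩, h.1.2⟩, fun h => ⟨⟨⟨h.1.1.trans hd, h.1.2⟩, h.2⟩, h.1.1⟩⟩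

/-- Every sum-zero triple meeting both `d` and its complement has exactly two pairs across. -/
theorem two_mul_wordCount_Hm {m : ℕ} {d : Finset (V m)} (hd : d ⊆ Hm m) :
    d.card * (Hm m \ d).card + 2 * (wordCount m d 3 + wordCount m (Hm m \ d) 3) =
      2 * wordCount m (Hm m) 3 := by
  have hP : d ×ˢ (Hm m \ d) ⊆ (Hm m).offDiag := by
    intro p hp
    obtain ⟨h1, h2⟩ := mem_product.1 hp
    obtain ⟨h2, h3⟩ := mem_sdiff.1 h2
    exact mem_offDiag.2 ⟨hd h1, h2, fun h => h3 (h ▸ h1)⟩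
  rw [← card_product, card_eq_sum_triples hP, ← card_triples, ← card_triples, ← card_triples,
    ← filter_triples_subset hd, ← filter_triples_subset (sdiff_subset : Hm m \ d ⊆ Hm m),
    card_filter, card_filter, ← sum_add_distrib, mul_sum, ← sum_add_distrib, card_eq_sum_ones,
    mul_sum]
  refine sum_congr rfl fun S hS => ?_
  obtain ⟨⟨hH, hc⟩, -⟩ := mem_triples.1 hS
  have hprod : (d ×ˢ (Hm m \ d)).filter (fun p => p.1 ∈ S ∧ p.2 ∈ S) = (S ∩ d) ×ˢ (S \ d) := by
    ext p
    simp only [mem_filter, mem_product, mem_inter, mem_sdiff]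
    exact ⟨fun h => ⟨⟨h.2.1, h.1.1⟩, h.2.2, h.1.2.2⟩,
      fun h => ⟨⟨h.1.2, hH h.2.1, h.2.2⟩, h.1.1, h.2.1⟩⟩
  have hsplit : (S ∩ d).card + (S \ d).card = 3 := by rw [card_inter_add_card_sdiff, hc]
  have h1 : S ⊆ d ↔ (S \ d).card = 0 := by rw [card_eq_zero, sdiff_eq_empty_iff_subset]
  have h2 : S ⊆ Hm m \ d ↔ (S ∩ d).card = 0 := by
    rw [card_eq_zero, ← disjoint_iff_inter_eq_empty, subset_sdiff]
    exact ⟨fun h => h.2, fun h => ⟨hH, h⟩⟩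
  rw [hprod, card_product]
  simp only [h1, h2]
  generalize (S ∩ d).card = a at *
  generalize (S \ d).card = b at *
  obtain rfl : b = 3 - a := by omega
  have ha : a ≤ 3 := by omega
  interval_cases a <;> simp

/-- For a design `d ⊆ H_m` with complement `d̄ = H_m \ d` of cardinality
`h`, one has `a₃(d) + a₃(d̄) = (2^m-1)(2^m-2)/6 - h(2^m-h-1)/2`; in particular,
among designs of fixed cardinality, minimizing `a₃(d)` is equivalent to maximizing
`a₃` of the complement. -/
theorem a3_plus_a3_complement (m : ℕ) (hm : 2 ≤ m)
    (d : Finset (V m)) (hd : d ⊆ Hm m) (h : ℕ) (hh : (Hm m \ d).card = h) :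
    wordCount m d 3 + wordCount m (Hm m \ d) 3 =
      (2 ^ m - 1) * (2 ^ m - 2) / 6 - h * (2 ^ m - h - 1) / 2 ∧
    (∀ d₁ ⊆ Hm m, ∀ d₂ ⊆ Hm m, d₁.card = d.card → d₂.card = d.card →
      (wordCount m d₁ 3 ≤ wordCount m d₂ 3 ↔
        wordCount m (Hm m \ d₂) 3 ≤ wordCount m (Hm m \ d₁) 3)) := by
  have hpos : 2 ≤ 2 ^ m := by
    calc 2 = 2 ^ 1 := rfl
      _ ≤ 2 ^ m := Nat.pow_le_pow_right (by norm_num) (by omega)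
  refine ⟨?_, fun d₁ h₁ d₂ h₂ c₁ c₂ => ?_⟩
  · have h2 := two_mul_wordCount_Hm hd
    have hcard : (Hm m \ d).card + d.card = 2 ^ m - 1 := by
      rw [card_sdiff_add_card_eq_card hd, card_Hm]
    rw [hh] at h2 hcard
    have hdc : d.card = 2 ^ m - h - 1 := by omega
    rw [← six_mul_wordCount_Hm, ← hdc, mul_comm h]
    omega
  · have e₁ := two_mul_wordCount_Hm h₁
    have e₂ := two_mul_wordCount_Hm h₂
    rw [card_sdiff_of_subset h₁, c₁] at e₁
    rw [card_sdiff_of_subset h₂, c₂] at e₂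
    omega
end

section
/- Let d ⊆ H_m be a minimum aberration design with |d| = k > 2^{m−1}. Then there exists a nonzero 𝔽₂-linear functional φ : V → ZMod 2 such that every v ∈ V with φ(v) = 1 belongs to d; that is, d contains the complement in H_m of a linear hyperplane, which is an isomorphic copy of O_m. -/
open Finset Polynomial

lemma add_add_self_cancel {G : Type*} [AddCommGroup G] [Module (ZMod 2) G]
    (x y : G) : x + (x + y) = y := by
  rw [← add_assoc, ZModModule.add_self, zero_add]

section SumTriples

variable {G : Type*} [AddCommGroup G] [DecidableEq G]

/-- The number of pairs in `X × Y` whose sum lies in `Z`. -/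
def sumTriples (X Y Z : Finset G) : ℕ :=
  #{p ∈ X ×ˢ Y | p.1 + p.2 ∈ Z}

lemma sumTriples_eq_sum (X Y Z : Finset G) :
    sumTriples X Y Z = ∑ x ∈ X, ∑ y ∈ Y, if x + y ∈ Z then 1 else 0 := by
  rw [sumTriples, card_filter, sum_product]

lemma sumTriples_comm (X Y Z : Finset G) : sumTriples X Y Z = sumTriples Y X Z := by
  rw [sumTriples_eq_sum, sumTriples_eq_sum, sum_comm]
  simp only [add_comm]

lemma sumTriples_le (X Y Z : Finset G) : sumTriples X Y Z ≤ #X * #Y := by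
  rw [← card_product]
  exact card_filter_le _ _

lemma sumTriples_eq_mul_iff (X Y Z : Finset G) :
    sumTriples X Y Z = #X * #Y ↔ ∀ x ∈ X, ∀ y ∈ Y, x + y ∈ Z := by
  rw [sumTriples, ← card_product, card_filter_eq_iff]
  simp only [mem_product, Prod.forall, and_imp]
  exact ⟨fun h x hx y hy => h x y hx hy, fun h x y hx hy => h x hx y hy⟩

lemma sumTriples_eq_zero {X Y Z : Finset G} (h : ∀ x ∈ X, ∀ y ∈ Y, x + y ∉ Z) :
    sumTriples X Y Z = 0 := by
  rw [sumTriples, card_eq_zero, filter_eq_empty_iff]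
  rintro ⟨x, y⟩ hp
  rw [mem_product] at hp
  exact h x hp.1 y hp.2

lemma sumTriples_union_left {X X' : Finset G} (h : Disjoint X X') (Y Z : Finset G) :
    sumTriples (X ∪ X') Y Z = sumTriples X Y Z + sumTriples X' Y Z := by
  simp only [sumTriples_eq_sum, sum_union h]

lemma sumTriples_union_middle (X : Finset G) {Y Y' : Finset G} (h : Disjoint Y Y')
    (Z : Finset G) : sumTriples X (Y ∪ Y') Z = sumTriples X Y Z + sumTriples X Y' Z := by
  simp only [sumTriples_comm X, sumTriples_union_left h]

lemma sumTriples_union_right (X Y : Finset G) {Z Z' : Finset G} (h : Disjoint Z Z') :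
    sumTriples X Y (Z ∪ Z') = sumTriples X Y Z + sumTriples X Y Z' := by
  rw [sumTriples, sumTriples, sumTriples, ← card_union_of_disjoint]
  · congr 1
    ext p
    simp only [mem_filter, mem_union]
    tauto
  · rw [disjoint_filter]
    exact fun p _ hp hp' => disjoint_left.1 h hp hp'

variable [Module (ZMod 2) G]

lemma sumTriples_swap_right (X Y Z : Finset G) : sumTriples X Y Z = sumTriples X Z Y := by
  refine card_nbij' (fun p => (p.1, p.1 + p.2)) (fun p => (p.1, p.1 + p.2)) ?_ ?_ ?_ ?_
  · rintro ⟨x, y⟩ h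
    simp_all [add_add_self_cancel]
  · rintro ⟨x, y⟩ h
    simp_all [add_add_self_cancel]
  · rintro ⟨x, y⟩ _
    simp [add_add_self_cancel]
  · rintro ⟨x, y⟩ _
    simp [add_add_self_cancel]

lemma sumTriples_union_self {X Y : Finset G} (h : Disjoint X Y) :
    sumTriples (X ∪ Y) (X ∪ Y) (X ∪ Y) =
      sumTriples X X X + 3 * sumTriples X X Y + 3 * sumTriples Y Y X + sumTriples Y Y Y := by
  simp only [sumTriples_union_left h, sumTriples_union_middle _ h, sumTriples_union_right _ _ h]
  have h₁ := sumTriples_swap_right X X Y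
  have h₂ := sumTriples_comm X Y X
  have h₃ := sumTriples_swap_right Y X Y
  have h₄ := sumTriples_comm X Y Y
  omega

/-- Two complementary subsets of a set closed under addition determine each other's number of
additive triples. -/
lemma sumTriples_add_sumTriples_compl {W A B : Finset G} (hW : ∀ x ∈ W, ∀ y ∈ W, x + y ∈ W)
    (hAB : Disjoint A B) (hU : A ∪ B = W) :
    sumTriples A A A + sumTriples B B B + #A * #B = #A * #A + #B * #B := by
  subst hU
  have key : ∀ X Y, X ⊆ A ∪ B → Y ⊆ A ∪ B →
      sumTriples X Y A + sumTriples X Y B = #X * #Y := fun X Y hX hY => by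
    rw [← sumTriples_union_right _ _ hAB, sumTriples_eq_mul_iff]
    exact fun x hx y hy => hW x (hX hx) y (hY hy)
  have h₁ := key A A subset_union_left subset_union_left
  have h₂ := key A B subset_union_left subset_union_right
  have h₃ := key B B subset_union_right subset_union_right
  have h₄ := sumTriples_swap_right A A B
  have h₅ := sumTriples_swap_right B A B
  have h₆ := sumTriples_comm A B B
  omega

/-- Splitting a set along the kernel of a linear functional. -/
lemma sumTriples_eq_of_functional (A : Finset G) (φ : Module.Dual (ZMod 2) G) :
    sumTriples A A A = sumTriples {a ∈ A | φ a = 0} {a ∈ A | φ a = 0} {a ∈ A | φ a = 0} +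
      3 * sumTriples {a ∈ A | ¬φ a = 0} {a ∈ A | ¬φ a = 0} {a ∈ A | φ a = 0} := by
  conv_lhs => rw [← filter_union_filter_not_eq (fun a => φ a = 0) A]
  have two : ∀ z : ZMod 2, z ≠ 0 → z = 1 := by decide
  rw [sumTriples_union_self (disjoint_filter_filter_not _ _ _)]
  rw [sumTriples_eq_zero (X := {a ∈ A | φ a = 0}) (Z := {a ∈ A | ¬φ a = 0}),
    sumTriples_eq_zero (X := {a ∈ A | ¬φ a = 0}) (Z := {a ∈ A | ¬φ a = 0})]
  · ring
  · intro x hx y hy h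
    simp only [mem_filter, map_add] at hx hy h
    rw [two _ hx.2, two _ hy.2] at h
    exact h.2 (by decide)
  · intro x hx y hy h
    simp only [mem_filter, map_add] at hx hy h
    simp [hx.2, hy.2] at h

end SumTriples

section Characters

/-- The nontrivial sign character of `ZMod 2`. -/
def binarySign (z : ZMod 2) : ℤ := if z = 0 then 1 else -1

lemma binarySign_add (x y : ZMod 2) : binarySign (x + y) = binarySign x * binarySign y := by
  revert x y
  decide

variable {G : Type*} [AddCommGroup G] [Module (ZMod 2) G]

/-- The character sum over `A` attached to a linear functional. -/
def characterSum (A : Finset G) (φ : Module.Dual (ZMod 2) G) : ℤ :=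
  ∑ a ∈ A, binarySign (φ a)

lemma characterSum_eq (A : Finset G) (φ : Module.Dual (ZMod 2) G) :
    characterSum A φ = #A - 2 * #{a ∈ A | φ a ≠ 0} := by
  simp only [characterSum, binarySign, ← card_filter_add_card_filter_not (s := A)
    (fun a => φ a = 0), sum_ite, sum_const]
  push_cast
  simp
  ring

variable [Fintype (Module.Dual (ZMod 2) G)] [DecidableEq G]

lemma sum_binarySign_dual (v : G) :
    ∑ φ : Module.Dual (ZMod 2) G, binarySign (φ v) =
      if v = 0 then (Fintype.card (Module.Dual (ZMod 2) G) : ℤ) else 0 := by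
  split_ifs with hv
  · simp [hv, binarySign]
  · obtain ⟨ψ, hψ⟩ : ∃ ψ : Module.Dual (ZMod 2) G, ψ v ≠ 0 := by
      by_contra! h
      exact hv ((Module.forall_dual_apply_eq_zero_iff (ZMod 2) v).1 h)
    have h := Equiv.sum_comp (Equiv.addRight ψ) fun φ : Module.Dual (ZMod 2) G => binarySign (φ v)
    have hneg : binarySign (ψ v) = -1 := if_neg hψ
    simp only [Equiv.coe_addRight, LinearMap.add_apply, binarySign_add, hneg, ← sum_mul] at h
    linarith

lemma sum_characterSum_sq (A : Finset G) :
    ∑ φ : Module.Dual (ZMod 2) G, characterSum A φ ^ 2 =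
      Fintype.card (Module.Dual (ZMod 2) G) * #A := by
  simp only [characterSum, sq, sum_mul_sum, ← binarySign_add, ← map_add]
  rw [sum_comm]
  simp_rw [sum_comm (s := univ), sum_binarySign_dual]
  have : ∀ x y : G, x + y = 0 ↔ x = y := fun x y => by
    rw [← ZModModule.sub_eq_add, sub_eq_zero]
  simp [this, mul_comm]

lemma sum_characterSum_cube (A : Finset G) :
    ∑ φ : Module.Dual (ZMod 2) G, characterSum A φ ^ 3 =
      Fintype.card (Module.Dual (ZMod 2) G) * sumTriples A A A := by
  have expand : ∀ φ : Module.Dual (ZMod 2) G, characterSum A φ ^ 3 =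
      ∑ x ∈ A, ∑ y ∈ A, ∑ z ∈ A, binarySign (φ (x + y + z)) := fun φ => by
    simp only [characterSum, pow_three', map_add, binarySign_add, sum_mul, mul_sum]
    exact sum_congr rfl fun x _ => sum_congr rfl fun y _ => sum_congr rfl fun z _ => by ring
  simp_rw [expand, sum_comm (s := univ), sum_binarySign_dual]
  have : ∀ x y : G, x + y = 0 ↔ x = y := fun x y => by
    rw [← ZModModule.sub_eq_add, sub_eq_zero]
  rw [sumTriples_eq_sum]
  push_cast
  simp only [mul_sum, mul_ite, mul_one, mul_zero, this, sum_ite_eq]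

/-- If every functional that does not vanish on `A` is nonzero at `p` or more points of `A`, and
`A` has at most half as many elements as its span, then `A` has few additive triples. -/
lemma sumTriples_add_mul_le (A : Finset G) (p : ℕ)
    (hp : ∀ φ : Module.Dual (ZMod 2) G, (∃ a ∈ A, φ a ≠ 0) → p ≤ #{a ∈ A | φ a ≠ 0})
    (hA : #{φ : Module.Dual (ZMod 2) G | ∀ a ∈ A, φ a = 0} * (2 * #A) ≤
      Fintype.card (Module.Dual (ZMod 2) G)) :
    sumTriples A A A + p * #A ≤ #A * #A := by
  set D := Fintype.card (Module.Dual (ZMod 2) G) with hD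
  set K := #{φ : Module.Dual (ZMod 2) G | ∀ a ∈ A, φ a = 0} with hK
  have hD0 : 0 < D := Fintype.card_pos
  have hsum : ∑ φ : Module.Dual (ZMod 2) G, (if ∀ a ∈ A, φ a = 0 then -2 * (p : ℤ) * #A ^ 2 else 0)
      ≤ ∑ φ : Module.Dual (ZMod 2) G,
        ((#A - 2 * p : ℤ) * characterSum A φ ^ 2 - characterSum A φ ^ 3) := by
    refine sum_le_sum fun φ _ => ?_
    split_ifs with h
    · have : characterSum A φ = #A := by
        rw [characterSum_eq, filter_false_of_mem (by simpa using h)]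
        simp
      rw [this]
      apply le_of_eq
      ring
    · push Not at h
      have h₁ : (p : ℤ) ≤ #{a ∈ A | φ a ≠ 0} := by exact_mod_cast hp φ h
      have h₂ := characterSum_eq A φ
      have : (#A - 2 * p : ℤ) * characterSum A φ ^ 2 - characterSum A φ ^ 3 =
        characterSum A φ ^ 2 * (#A - 2 * p - characterSum A φ) := by ring
      rw [this]
      exact mul_nonneg (sq_nonneg _) (by linarith)
  rw [← sum_filter, sum_const, sum_sub_distrib, ← mul_sum, sum_characterSum_sq,
    sum_characterSum_cube, ← hD, ← hK, nsmul_eq_mul] at hsum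
  have hA' : (K : ℤ) * (2 * #A) * (p * #A) ≤ D * (p * #A) := by
    exact_mod_cast Nat.mul_le_mul_right _ hA
  have : (D : ℤ) * (sumTriples A A A + p * #A) ≤ D * (#A * #A) := by linarith
  exact_mod_cast le_of_mul_le_mul_left this (by exact_mod_cast hD0)

end Characters

section Extremal

variable {G : Type*} [AddCommGroup G] [Module (ZMod 2) G]

lemma natCard_span_le_of_two_cosets [DecidableEq G] {A A₀ : Finset G} {b : G}
    (hne : A₀.Nonempty) (hadd : ∀ x ∈ A₀, ∀ y ∈ A₀, x + y ∈ A₀)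
    (hA : ∀ a ∈ A, a ∈ A₀ ∨ b + a ∈ A₀) :
    Nat.card (Submodule.span (ZMod 2) (A : Set G)) ≤ 2 * #A₀ := by
  have zero_mem : (0 : G) ∈ A₀ := by
    obtain ⟨a, ha⟩ := hne
    simpa [ZModModule.add_self] using hadd a ha a ha
  have span_subset : (Submodule.span (ZMod 2) (A : Set G) : Set G) ⊆
      (A₀ ∪ A₀.image (b + ·) : Finset G) := by
    intro x hx
    have : x ∈ A₀ ∨ b + x ∈ A₀ := by
      induction hx using Submodule.span_induction with
      | mem x hx => exact hA x hx
      | zero => exact Or.inl zero_mem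
      | add x y _ _ hx hy =>
        rcases hx with hx | hx <;> rcases hy with hy | hy
        · exact Or.inl (hadd x hx y hy)
        · refine Or.inr ?_
          rw [add_left_comm]
          exact hadd x hx _ hy
        · refine Or.inr ?_
          rw [← add_assoc]
          exact hadd _ hx y hy
        · refine Or.inl ?_
          have := hadd _ hx _ hy
          rwa [add_add_add_comm, ZModModule.add_self, zero_add] at this
      | smul c x _ hx =>
        have hc : ∀ c : ZMod 2, c = 0 ∨ c = 1 := by decide
        rcases hc c with rfl | rfl
        · simpa using Or.inl zero_mem
        · simpa using hx
    rw [coe_union, coe_image]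
    refine this.imp id fun h => ⟨b + x, h, add_add_self_cancel b x⟩
  calc Nat.card (Submodule.span (ZMod 2) (A : Set G))
      ≤ Nat.card ((A₀ ∪ A₀.image (b + ·) : Finset G) : Set G) :=
        Nat.card_mono (finite_toSet _) span_subset
    _ = #(A₀ ∪ A₀.image (b + ·)) := by rw [Nat.card_coe_set_eq, Set.ncard_coe_finset]
    _ ≤ #A₀ + #(A₀.image (b + ·)) := card_union_le _ _
    _ ≤ 2 * #A₀ := by
        have := card_image_le (s := A₀) (f := (b + ·))
        omega

lemma exists_natCard_span_eq_two_pow (A : Finset G) :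
    ∃ j, Nat.card (Submodule.span (ZMod 2) (A : Set G)) = 2 ^ j :=
  ⟨_, by rw [Module.natCard_eq_pow_finrank (K := ZMod 2), Nat.card_zmod]⟩

variable [Finite G]

lemma card_le_natCard_span (A : Finset G) :
    #A ≤ Nat.card (Submodule.span (ZMod 2) (A : Set G)) := by
  have h := Nat.card_mono (Set.toFinite _) (Submodule.subset_span (R := ZMod 2) (s := (A : Set G)))
  simpa using h

lemma card_annihilator_mul_natCard_span [Fintype (Module.Dual (ZMod 2) G)] [DecidableEq G]
    (A : Finset G) :
    #{φ : Module.Dual (ZMod 2) G | ∀ a ∈ A, φ a = 0} *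
      Nat.card (Submodule.span (ZMod 2) (A : Set G)) = Fintype.card (Module.Dual (ZMod 2) G) := by
  set W := Submodule.span (ZMod 2) (A : Set G)
  have h : #{φ : Module.Dual (ZMod 2) G | ∀ a ∈ A, φ a = 0} = Nat.card W.dualAnnihilator := by
    have hmem : ∀ φ, φ ∈ W.dualAnnihilator ↔ ∀ a ∈ A, φ a = 0 := fun φ => by
      rw [Submodule.mem_dualAnnihilator]
      refine ⟨fun h a ha => h a (Submodule.subset_span ha), fun h w hw => ?_⟩
      exact (Submodule.span_le (p := LinearMap.ker φ)).2 h hw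
    rw [← Set.ncard_coe_finset, ← Nat.card_coe_set_eq]
    congr 2
    ext φ
    simp [hmem]
  have := Module.finite_of_finite (ZMod 2) (M := Module.Dual (ZMod 2) G)
  rw [h, Module.natCard_eq_pow_finrank (K := ZMod 2) (V := W.dualAnnihilator),
    Module.natCard_eq_pow_finrank (K := ZMod 2) (V := W), ← pow_add, add_comm,
    Subspace.finrank_add_finrank_dualAnnihilator_eq, ← Subspace.dual_finrank_eq,
    ← Module.natCard_eq_pow_finrank, Nat.card_eq_fintype_card]

variable [DecidableEq G]

/-- A set of `2 ^ r + s` elements with at least `4 ^ r + 3 * s ^ 2` additive triples spans at most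
`2 ^ (r + 1)` elements, provided no proper subset exceeds the corresponding bound. -/
lemma natCard_span_le_of_le_sumTriples {A : Finset G} {r s : ℕ} (hs₁ : 1 ≤ s) (hs : s ≤ 2 ^ r)
    (hA : #A = 2 ^ r + s)
    (ih : ∀ B ⊂ A, ∀ r s, s ≤ 2 ^ r → #B = 2 ^ r + s → sumTriples B B B ≤ 4 ^ r + 3 * s ^ 2)
    (hT : 4 ^ r + 3 * s ^ 2 ≤ sumTriples A A A) :
    Nat.card (Submodule.span (ZMod 2) (A : Set G)) ≤ 2 ^ (r + 1) := by
  have := Module.finite_of_finite (ZMod 2) (M := Module.Dual (ZMod 2) G)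
  have := Fintype.ofFinite (Module.Dual (ZMod 2) G)
  by_contra! hspan
  have hfour : 4 * 2 ^ r ≤ Nat.card (Submodule.span (ZMod 2) (A : Set G)) := by
    obtain ⟨j, hj⟩ := exists_natCard_span_eq_two_pow A
    rw [hj] at hspan ⊢
    have := Nat.pow_lt_pow_iff_right (by norm_num) |>.1 hspan
    calc 4 * 2 ^ r = 2 ^ (r + 2) := by ring
      _ ≤ 2 ^ j := Nat.pow_le_pow_right (by norm_num) this
  obtain ⟨φ, hφ, hmin⟩ : ∃ φ : Module.Dual (ZMod 2) G, (∃ a ∈ A, φ a ≠ 0) ∧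
      ∀ ψ : Module.Dual (ZMod 2) G, (∃ a ∈ A, ψ a ≠ 0) →
        #{a ∈ A | φ a ≠ 0} ≤ #{a ∈ A | ψ a ≠ 0} := by
    have hne : ({φ | ∃ a ∈ A, φ a ≠ 0} : Finset (Module.Dual (ZMod 2) G)).Nonempty := by
      have := Nat.one_le_two_pow (n := r)
      obtain ⟨a, ha, ha0⟩ := exists_mem_ne (s := A) (by omega) 0
      have : ∃ φ : Module.Dual (ZMod 2) G, φ a ≠ 0 := by
        by_contra! h
        exact ha0 ((Module.forall_dual_apply_eq_zero_iff (ZMod 2) a).1 h)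
      obtain ⟨φ, hφ⟩ := this
      exact ⟨φ, by simpa using ⟨a, ha, hφ⟩⟩
    obtain ⟨φ, hφ, h⟩ := exists_min_image _
      (fun φ : Module.Dual (ZMod 2) G => #{a ∈ A | φ a ≠ 0}) hne
    exact ⟨φ, by simpa using hφ, fun ψ hψ => h ψ (by simpa using hψ)⟩
  have hsplit := sumTriples_eq_of_functional A φ
  have hcard := card_filter_add_card_filter_not (s := A) (fun a => φ a = 0)
  have hspectral := sumTriples_add_mul_le A _ hmin <| by
    rw [← card_annihilator_mul_natCard_span A]
    exact Nat.mul_le_mul_left _ (by omega)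
  set A₀ := {a ∈ A | φ a = 0}
  set A₁ := {a ∈ A | ¬φ a = 0}
  obtain ⟨b, hbA, hb⟩ := hφ
  have hbA₁ : b ∈ A₁ := mem_filter.2 ⟨hbA, hb⟩
  have hp : 1 ≤ #A₁ := card_pos.2 ⟨b, hbA₁⟩
  have hssub : A₀ ⊂ A := filter_ssubset.2 ⟨b, hbA, hb⟩
  have hC := sumTriples_le A₁ A₁ A₀
  change sumTriples A A A + #A₁ * #A ≤ _ at hspectral
  set p := #A₁ with hpdef
  have h4 : 4 ^ r = 2 ^ r * 2 ^ r := by norm_num [← mul_pow]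
  set R := 2 ^ r with hR
  rcases lt_trichotomy p s with hps | hps | hps
  · have h₀ := ih A₀ hssub r (s - p) (by omega) (by omega)
    obtain ⟨t, rfl⟩ := Nat.exists_eq_add_of_lt hps
    rw [show p + t + 1 - p = t + 1 by omega] at h₀
    nlinarith
  · have h₀ := sumTriples_le A₀ A₀ A₀
    have hc₀ : #A₀ = R := by omega
    rw [hc₀] at h₀
    have e₀ : sumTriples A₀ A₀ A₀ = #A₀ * #A₀ := by
      rw [hc₀]
      nlinarith
    have e₁ : sumTriples A₁ A₁ A₀ = #A₁ * #A₁ := by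
      rw [← hpdef]
      nlinarith
    rw [sumTriples_eq_mul_iff] at e₀ e₁
    have := natCard_span_le_of_two_cosets (A := A) (A₀ := A₀) (b := b)
      (card_pos.1 (by omega)) e₀ fun a ha => by
        by_cases h : φ a = 0
        · exact Or.inl (mem_filter.2 ⟨ha, h⟩)
        · exact Or.inr (e₁ b hbA₁ a (mem_filter.2 ⟨ha, h⟩))
    omega
  · rw [hA] at hspectral
    have h2p : 2 * p < R := by
      by_contra! h
      have h₁ := Nat.mul_le_mul_right (R + s) h
      have h₂ : R * (R + s) + 2 * (R * R + 3 * s ^ 2) ≤ 2 * ((R + s) * (R + s)) := by linarith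
      have h₃ : 0 < s ^ 2 := by positivity
      zify at h₂ h₃
      linarith [sq_nonneg (2 * (R : ℤ) - 3 * s)]
    obtain ⟨q, rfl⟩ : ∃ q, r = q + 1 := Nat.exists_eq_succ_of_ne_zero <| by
      rintro rfl
      norm_num [hR] at h2p
      omega
    have hQ : R = 2 * 2 ^ q := by rw [hR, pow_succ']
    have h4q : 4 ^ q = 2 ^ q * 2 ^ q := by norm_num [← mul_pow]
    have h₀ := ih A₀ hssub q (2 ^ q + s - p) (by omega) (by omega)
    rw [h4q] at h₀
    set Q := 2 ^ q
    obtain ⟨t, ht⟩ : ∃ t, t = Q + s - p := ⟨_, rfl⟩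
    rw [← ht] at h₀
    have ht' : t + p = Q + s := by omega
    obtain ⟨x, hx⟩ := Nat.exists_eq_add_of_lt hps
    rw [hx] at hC ht'
    rw [h4, hQ] at hT
    rw [hQ, hx] at h2p
    have htot : Q * Q + 3 * s ^ 2 + 3 * (Q * Q) ≤
        Q * Q + 3 * t ^ 2 + 3 * ((s + x + 1) * (s + x + 1)) := by linarith
    have hlt := Nat.mul_lt_mul_of_pos_left h2p (Nat.succ_pos x)
    zify at htot hlt ht'
    have : (t : ℤ) = Q - (x + 1) := by linarith
    rw [this] at htot
    linarith

/-- The maximal number of additive triples in a set of `2 ^ r + s` elements. -/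
lemma sumTriples_le_of_card_eq (A : Finset G) :
    ∀ r s, s ≤ 2 ^ r → #A = 2 ^ r + s → sumTriples A A A ≤ 4 ^ r + 3 * s ^ 2 := by
  induction A using Finset.strongInduction with
  | H A ih =>
    intro r s hs hA
    have h4 : 4 ^ r = 2 ^ r * 2 ^ r := by norm_num [← mul_pow]
    rcases Nat.eq_zero_or_pos s with rfl | hs₁
    · have := sumTriples_le A A A
      rw [hA] at this
      simpa [h4] using this
    by_contra! hT
    have hspan := natCard_span_le_of_le_sumTriples hs₁ hs hA ih hT.le
    have hle := card_le_natCard_span A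
    obtain ⟨j, hj⟩ := exists_natCard_span_eq_two_pow A
    rw [hj, Nat.pow_le_pow_iff_right (by norm_num)] at hspan
    have hj' : r < j := by
      rw [← Nat.pow_lt_pow_iff_right (a := 2) (by norm_num), ← hj]
      omega
    obtain rfl : j = r + 1 := by omega
    classical
    have := Fintype.ofFinite G
    set W : Finset G := {x | x ∈ Submodule.span (ZMod 2) (A : Set G)} with hW
    have hWcard : #W = 2 ^ (r + 1) := by
      rw [← hj, Nat.card_eq_fintype_card, Fintype.card_subtype]
    have hAW : A ⊆ W := fun a ha => by simpa [hW] using Submodule.subset_span ha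
    have h₁ := sumTriples_add_sumTriples_compl (W := W) (A := A) (B := W \ A)
      (by simpa [hW] using fun x hx y hy => Submodule.add_mem _ hx hy)
      disjoint_sdiff (union_sdiff_of_subset hAW)
    have h₂ := card_sdiff_add_card_eq_card hAW
    rw [hWcard, hA, pow_succ'] at h₂
    rw [hA] at h₁
    set u := #(W \ A)
    obtain ⟨t, ht⟩ : ∃ t, 2 ^ r = u + s := ⟨0, by omega⟩
    rw [ht] at h₁ h4
    nlinarith

end Extremal

lemma exists_le_sumTriples {G : Type*} [AddCommGroup G] [Module (ZMod 2) G] [Finite G]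
    [DecidableEq G] {r s : ℕ} (hs : s ≤ 2 ^ r) (hr : r < Module.finrank (ZMod 2) G) :
    ∃ A : Finset G, 0 ∈ A ∧ #A = 2 ^ r + s ∧ 4 ^ r + 3 * s ^ 2 ≤ sumTriples A A A := by
  classical
  have := Fintype.ofFinite G
  obtain ⟨f, hf⟩ := exists_linearIndependent_of_le_finrank hr.le
  set U := Submodule.span (ZMod 2) (Set.range f) with hU
  have hUrank : Module.finrank (ZMod 2) U = r := by
    rw [finrank_span_eq_card hf, Fintype.card_fin]
  obtain ⟨b, hb⟩ : ∃ b, b ∉ U := by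
    by_contra! h
    rw [(Submodule.eq_top_iff' (p := U)).2 h, finrank_top] at hUrank
    omega
  set X : Finset G := {x | x ∈ U} with hX
  have hXmem : ∀ x, x ∈ X ↔ x ∈ U := by simp [hX]
  have hXcard : #X = 2 ^ r := by
    rw [← Fintype.card_subtype, ← Nat.card_eq_fintype_card]
    exact (Module.natCard_eq_pow_finrank (K := ZMod 2) (V := U)).trans
      (by rw [hUrank, Nat.card_zmod])
  obtain ⟨Y₀, hY₀, hY₀card⟩ := exists_subset_card_eq (hXcard ▸ hs)
  set Y := Y₀.image (b + ·) with hY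
  have hYcard : #Y = s := by
    rw [card_image_of_injective _ (add_right_injective b), hY₀card]
  have hdisj : Disjoint X Y := by
    refine disjoint_left.2 fun x hx hxY => ?_
    obtain ⟨y, hy, rfl⟩ := mem_image.1 hxY
    exact hb ((Submodule.add_mem_iff_left U ((hXmem y).1 (hY₀ hy))).1 ((hXmem _).1 hx))
  have hXX : sumTriples X X X = #X * #X := by
    rw [sumTriples_eq_mul_iff]
    simpa only [hXmem] using fun x hx y hy => U.add_mem hx hy
  have hYY : sumTriples Y Y X = #Y * #Y := by
    rw [sumTriples_eq_mul_iff]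
    intro x hx y hy
    obtain ⟨x, hx', rfl⟩ := mem_image.1 hx
    obtain ⟨y, hy', rfl⟩ := mem_image.1 hy
    rw [hXmem, add_add_add_comm, ZModModule.add_self, zero_add]
    exact U.add_mem ((hXmem x).1 (hY₀ hx')) ((hXmem y).1 (hY₀ hy'))
  refine ⟨X ∪ Y, mem_union_left _ ((hXmem 0).2 U.zero_mem), ?_, ?_⟩
  · rw [card_union_of_disjoint hdisj, hXcard, hYcard]
  · have h4 : 4 ^ r = 2 ^ r * 2 ^ r := by norm_num [← mul_pow]
    rw [sumTriples_union_self hdisj, hXX, hYY, hXcard, hYcard, h4, sq]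
    omega

section WordCount

variable {m : ℕ}

lemma wordCount_zero (d : Finset (V m)) : wordCount m d 0 = 1 := by
  simp [wordCount, sumCount, filter_singleton]

lemma wordCount_one {d : Finset (V m)} (hd : d ⊆ Hm m) : wordCount m d 1 = 0 := by
  rw [wordCount, sumCount, card_eq_zero, filter_eq_empty_iff]
  intro S hS hsum
  obtain ⟨hSd, hS⟩ := mem_powersetCard.1 hS
  obtain ⟨a, rfl⟩ := card_eq_one.1 hS
  have := hd (hSd (mem_singleton_self a))
  simp_all [Hm]

lemma wordCount_two (d : Finset (V m)) : wordCount m d 2 = 0 := by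
  rw [wordCount, sumCount, card_eq_zero, filter_eq_empty_iff]
  intro S hS hsum
  obtain ⟨a, b, hab, rfl⟩ := card_eq_two.1 (mem_powersetCard.1 hS).2
  rw [sum_pair hab, id, id, ← ZModModule.sub_eq_add, sub_eq_zero] at hsum
  exact hab hsum

lemma six_mul_wordCount_three {d : Finset (V m)} (hd : d ⊆ Hm m) :
    6 * wordCount m d 3 = sumTriples d d d := by
  have hd0 : (0 : V m) ∉ d := fun h => by simpa [Hm] using hd h
  have hne : ∀ x ∈ d, ∀ y ∈ d, x + y ∈ d → x ≠ y ∧ x ≠ x + y ∧ y ≠ x + y := by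
    intro x hx y hy hxy
    refine ⟨?_, fun h => hd0 ?_, fun h => hd0 ?_⟩
    · rintro rfl
      exact hd0 (ZModModule.add_self x ▸ hxy)
    · rwa [left_eq_add.1 h] at hy
    · rwa [right_eq_add.1 h] at hx
  rw [sumTriples, card_eq_sum_card_fiberwise (f := fun p : V m × V m => {p.1, p.2, p.1 + p.2})
    (t := {S ∈ d.powersetCard 3 | S.sum id = 0})]
  · rw [sum_congr rfl (g := fun _ => 6), sum_const, smul_eq_mul, mul_comm]
    · rfl
    intro S hS
    obtain ⟨hS, hsum⟩ := mem_filter.1 hS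
    obtain ⟨hSd, hcard⟩ := mem_powersetCard.1 hS
    have : #S.offDiag = 6 := by rw [offDiag_card, hcard]
    rw [← this]
    congr 1
    ext ⟨x, y⟩
    simp only [mem_filter, mem_product, mem_offDiag]
    constructor
    · rintro ⟨⟨⟨hx, hy⟩, hxy⟩, rfl⟩
      simpa using (hne x hx y hy hxy).1
    · rintro ⟨hx, hy, hxy⟩
      obtain ⟨z, hz⟩ : ∃ z, S \ {x, y} = {z} := by
        rw [← card_eq_one, card_sdiff_of_subset (by simp [insert_subset_iff, hx, hy]), hcard,
          card_pair hxy]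
      have hSz : S = {x, y, z} := by
        rw [← sdiff_union_of_subset (show {x, y} ⊆ S by simp [insert_subset_iff, hx, hy]), hz]
        ext
        simp only [mem_union, mem_insert, mem_singleton]
        tauto
      have hz' : z ∈ S \ {x, y} := hz ▸ mem_singleton_self z
      simp only [mem_sdiff, mem_insert, mem_singleton, not_or] at hz'
      have hxyz : x + y = z := by
        rw [hSz, sum_insert (by simp [hxy, Ne.symm hz'.2.1]), sum_pair (Ne.symm hz'.2.2)] at hsum
        rw [← sub_eq_zero, ZModModule.sub_eq_add, add_assoc]
        exact hsum
      rw [hxyz]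
      exact ⟨⟨⟨hSd hx, hSd hy⟩, hSd hz'.1⟩, hSz.symm⟩
  · rintro ⟨x, y⟩ h
    simp only [coe_filter, mem_product, Set.mem_ofPred_eq] at h
    obtain ⟨⟨hx, hy⟩, hxy⟩ := h
    obtain ⟨h₁, h₂, h₃⟩ := hne x hx y hy hxy
    simp only [coe_filter, mem_powersetCard, Set.mem_ofPred_eq]
    refine ⟨⟨by simp [insert_subset_iff, hx, hy, hxy],
      card_eq_three.2 ⟨_, _, _, h₁, h₂, h₃, rfl⟩⟩, ?_⟩
    rw [sum_insert (by simp [h₁, h₂]), sum_pair h₃]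
    simp only [id]
    rw [← add_assoc, ZModModule.add_self]

/-- A minimum aberration design minimizes the number of words of length three. -/
lemma IsMA.wordCount_three_le {d d' : Finset (V m)} (hMA : IsMA m d) (hd' : d' ⊆ Hm m)
    (hcard : #d' = #d) : wordCount m d 3 ≤ wordCount m d' 3 := by
  by_contra! h
  refine hMA.2 d' hd' hcard ⟨3, by norm_num, h, fun t ht => ?_⟩
  interval_cases t
  · rw [wordCount_zero, wordCount_zero]
  · rw [wordCount_one hd', wordCount_one hMA.1]
  · rw [wordCount_two, wordCount_two]

/-- The complement of a minimum aberration design maximizes the number of additive triples among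
the sets of its cardinality that contain `0`. -/
lemma IsMA.sumTriples_compl_le {d A : Finset (V m)} (hMA : IsMA m d) (h0 : 0 ∈ A)
    (hA : #A = #dᶜ) : sumTriples A A A ≤ sumTriples dᶜ dᶜ dᶜ := by
  have hA' : Aᶜ ⊆ Hm m := fun v hv => by
    simp only [Hm, mem_filter, mem_univ, true_and]
    rintro rfl
    exact (mem_compl.1 hv) h0
  have hcard : #Aᶜ = #d := by rw [card_compl, hA, card_compl, Nat.sub_sub_self (card_le_univ d)]
  have h₁ := hMA.wordCount_three_le hA' hcard
  have h₂ := six_mul_wordCount_three hMA.1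
  have h₃ := six_mul_wordCount_three hA'
  have h₄ := sumTriples_add_sumTriples_compl (W := univ) (by simp)
    (disjoint_compl_right (a := d)) (union_compl d)
  have h₅ := sumTriples_add_sumTriples_compl (W := univ) (by simp)
    (disjoint_compl_left (a := A)) (by rw [union_comm, union_compl])
  rw [hcard, hA] at h₅
  omega

lemma span_compl_lt_top_of_isMA {d : Finset (V m)} (hm : 2 ≤ m) (hk : 2 ^ (m - 1) < #d)
    (hMA : IsMA m d) : Submodule.span (ZMod 2) ((dᶜ : Finset (V m)) : Set (V m)) < ⊤ := by
  have h0 : (0 : V m) ∈ dᶜ := mem_compl.2 fun h => by simpa [Hm] using hMA.1 h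
  have hV : Fintype.card (V m) = 2 ^ m := by simp
  have hpow : 2 ^ m = 2 * 2 ^ (m - 1) := by rw [← pow_succ', Nat.sub_add_cancel (by omega)]
  have hlt : #dᶜ < 2 ^ (m - 1) := by
    have := Nat.two_pow_pos (m - 1)
    rw [card_compl, hV]
    omega
  have hpos : 1 ≤ #dᶜ := card_pos.2 ⟨0, h0⟩
  rcases hpos.eq_or_lt with h1 | h1
  · obtain ⟨a, ha⟩ := card_eq_one.1 h1.symm
    have : NeZero m := ⟨by omega⟩
    rw [ha, mem_singleton] at h0
    rw [ha, ← h0, coe_singleton, Submodule.span_zero_singleton]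
    exact bot_lt_top
  obtain ⟨r, hr⟩ : ∃ r, r = Nat.log 2 (#dᶜ - 1) := ⟨_, rfl⟩
  have hle : 2 ^ r ≤ #dᶜ - 1 := hr ▸ Nat.pow_log_le_self 2 (by omega)
  have hlt' : #dᶜ - 1 < 2 ^ (r + 1) := hr ▸ Nat.lt_pow_succ_log_self (by norm_num) _
  have hpow' : 2 ^ (r + 1) = 2 * 2 ^ r := pow_succ' 2 r
  have hrm : r < m - 1 := (Nat.pow_lt_pow_iff_right (a := 2) (by norm_num)).1 (by omega)
  have hs : #dᶜ - 2 ^ r ≤ 2 ^ r := by omega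
  have hcard : #dᶜ = 2 ^ r + (#dᶜ - 2 ^ r) := by omega
  obtain ⟨A, hA0, hA, hAT⟩ := exists_le_sumTriples (G := V m) hs (by simp; omega)
  have hspan := natCard_span_le_of_le_sumTriples (by omega) hs hcard
    (fun B _ => sumTriples_le_of_card_eq B)
    (hAT.trans (hMA.sumTriples_compl_le hA0 (hA.trans hcard.symm)))
  refine lt_top_iff_ne_top.2 fun htop => ?_
  rw [htop, Nat.card_congr (Submodule.topEquiv (R := ZMod 2) (M := V m)).toEquiv,
    Nat.card_eq_fintype_card, hV, Nat.pow_le_pow_iff_right (by norm_num)] at hspan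
  omega

end WordCount

/-- A minimum aberration design `d ⊆ H_m` with more than `2^{m-1}`
factors contains the complement in `H_m` of a linear hyperplane, i.e. an isomorphic
copy of the saturated resolution-IV design `O_m`. -/
theorem MA_contains_copy_of_Om (m : ℕ) (hm : 2 ≤ m)
    (d : Finset (V m)) (hd : d ⊆ Hm m) (hk : 2 ^ (m - 1) < d.card)
    (hMA : IsMA m d) :
    ∃ φ : V m →ₗ[ZMod 2] ZMod 2, φ ≠ 0 ∧ ∀ v : V m, φ v = 1 → v ∈ d := by
  obtain ⟨φ, hφ, hle⟩ :=
    Submodule.exists_le_ker_of_lt_top _ (span_compl_lt_top_of_isMA hm hk hMA)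
  refine ⟨φ, hφ, fun v hv => ?_⟩
  by_contra hvd
  have : φ v = 0 := hle (Submodule.subset_span (mem_coe.2 (mem_compl.2 hvd)))
  simp [this] at hv
end

section
/- Let 1 ≤ v ≤ m and let f₁, f₂ ⊆ H_m be two subsets each of cardinality 2^v − 1 and rank v. Then there exists a linear automorphism T of V with T(f₁) = f₂; that is, all minimum-rank subsets of H_m of cardinality 2^v − 1 are isomorphic. -/
open Finset Polynomial

/-- A set of `2 ^ v - 1` nonzero vectors of rank `v` consists of all nonzero vectors of its span. -/
theorem mem_iff_mem_span_of_rankOf_eq {m v : ℕ} {f : Finset (V m)} (hf : f ⊆ Hm m)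
    (hc : f.card = 2 ^ v - 1) (hr : rankOf m f = v) (x : V m) :
    x ∈ f ↔ x ∈ Submodule.span (ZMod 2) (f : Set (V m)) ∧ x ≠ 0 := by
  classical
  set W := Submodule.span (ZMod 2) (f : Set (V m))
  have hcard : Nat.card W = 2 ^ v := by
    have h := Module.natCard_eq_pow_finrank (K := ZMod 2) (V := W)
    rwa [Nat.card_zmod, show Module.finrank (ZMod 2) W = v from hr] at h
  have h0 : (0 : V m) ∉ f := fun h => by simpa [Hm] using hf h
  have hsub : insert 0 f ⊆ Finset.univ.filter (fun y => y ∈ W) := by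
    intro y hy
    rcases Finset.mem_insert.mp hy with rfl | hy
    · simp
    · simpa using Submodule.subset_span (Finset.mem_coe.mpr hy)
  have heq : insert 0 f = Finset.univ.filter (fun y => y ∈ W) := by
    refine Finset.eq_of_subset_of_card_le hsub ?_
    rw [Finset.card_insert_of_notMem h0, hc, Nat.sub_add_cancel Nat.one_le_two_pow, ← hcard,
      Nat.card_eq_fintype_card, Fintype.card_subtype]
  have hx : x ∈ insert 0 f ↔ x ∈ W := by simp [heq]
  rw [← hx, Finset.mem_insert]
  constructor
  · exact fun h => ⟨Or.inr h, fun h' => h0 (h' ▸ h)⟩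
  · rintro ⟨h | h, h'⟩
    · exact absurd h h'
    · exact h

/-- Any two subsets of `H_m` of cardinality `2^v - 1` and rank `v`
(`1 ≤ v ≤ m`) are isomorphic via a linear automorphism of `V`. -/
theorem minimum_rank_sets_isomorphic (m v : ℕ) (hm : 2 ≤ m)
    (hv1 : 1 ≤ v) (hv2 : v ≤ m)
    (f₁ f₂ : Finset (V m)) (hf₁ : f₁ ⊆ Hm m) (hf₂ : f₂ ⊆ Hm m)
    (hc₁ : f₁.card = 2 ^ v - 1) (hc₂ : f₂.card = 2 ^ v - 1)
    (hr₁ : rankOf m f₁ = v) (hr₂ : rankOf m f₂ = v) :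
    ∃ T : V m ≃ₗ[ZMod 2] V m, f₁.image (fun x => T x) = f₂ := by
  obtain ⟨e⟩ : Nonempty (Submodule.span (ZMod 2) (f₁ : Set (V m)) ≃ₗ[ZMod 2]
      Submodule.span (ZMod 2) (f₂ : Set (V m))) :=
    FiniteDimensional.nonempty_linearEquiv_of_finrank_eq (hr₁.trans hr₂.symm)
  obtain ⟨T, hT⟩ := Submodule.exists_linearEquiv_restrict_eq e
  refine ⟨T, ?_⟩
  have hTm : ∀ x ∈ f₁, T x ∈ f₂ := by
    intro x hx
    obtain ⟨hxW, hx0⟩ := (mem_iff_mem_span_of_rankOf_eq hf₁ hc₁ hr₁ x).mp hx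
    refine (mem_iff_mem_span_of_rankOf_eq hf₂ hc₂ hr₂ _).mpr ⟨?_, by simpa using hx0⟩
    have h := hT ⟨x, hxW⟩
    simp only at h
    rw [← h]
    exact (e ⟨x, hxW⟩).2
  refine Finset.eq_of_subset_of_card_le (Finset.image_subset_iff.mpr hTm) ?_
  rw [Finset.card_image_of_injective _ T.injective, hc₁, hc₂]
end

section
/- Let d ⊆ H_m with |d| = 2^{m−1} and a_3(d) = 0 (i.e. no three distinct elements of d sum to 0, so d has resolution at least IV). Then there exists a nonzero 𝔽₂-linear functional φ : V → ZMod 2 with d = {v ∈ V : φ(v) = 1}. In particular, the resolution-IV design with 2^{m−1} factors and 2^m runs is unique up to isomorphism. -/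
open Finset Polynomial

/-- A design without zero-sum triples is sum-free. -/
lemma add_notMem_of_wordCount_three_eq_zero {m : ℕ} {d : Finset (V m)} (hd : d ⊆ Hm m)
    (ha3 : wordCount m d 3 = 0) {x y : V m} (hx : x ∈ d) (hy : y ∈ d) : x + y ∉ d := by
  intro hxy
  have ne_zero : ∀ v ∈ d, v ≠ 0 := fun v hv => (Finset.mem_filter.mp (hd hv)).2
  have hne : x ≠ y := by
    rintro rfl
    exact ne_zero _ hxy (ZModModule.add_self x)
  have hx' : x ≠ x + y := fun h => ne_zero y hy (left_eq_add.mp h)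
  have hy' : y ≠ x + y := fun h => ne_zero x hx (right_eq_add.mp h)
  have hmem : ({x, y, x + y} : Finset (V m)) ∈
      (d.powersetCard 3).filter (fun S => S.sum id = 0) := by
    rw [Finset.mem_filter, Finset.mem_powersetCard]
    refine ⟨⟨?_, Finset.card_eq_three.mpr ⟨x, y, x + y, hne, hx', hy', rfl⟩⟩, ?_⟩
    · simp [Finset.insert_subset_iff, hx, hy, hxy]
    · rw [Finset.sum_insert (by simp [hne, ne_zero y hy]), Finset.sum_pair hy']
      simp only [id]
      rw [← add_assoc, ZModModule.add_self]
  exact Finset.notMem_empty _ (Finset.card_eq_zero.mp ha3 ▸ hmem)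

/-- In a half-size sum-free set, adding an element of the set exchanges the set
and its complement. -/
lemma add_mem_iff_notMem_of_sumFree {m : ℕ} (hm : 1 ≤ m) {d : Finset (V m)}
    (hcard : d.card = 2 ^ (m - 1)) (hfree : ∀ x ∈ d, ∀ y ∈ d, x + y ∉ d)
    {x : V m} (hx : x ∈ d) (y : V m) : x + y ∈ d ↔ y ∉ d := by
  have himage : d.image (x + ·) = dᶜ := by
    apply Finset.eq_of_subset_of_card_le
    · intro z hz
      obtain ⟨y, hy, rfl⟩ := Finset.mem_image.mp hz
      exact Finset.mem_compl.mpr (hfree x hx y hy)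
    · rw [Finset.card_image_of_injective _ (add_right_injective x), Finset.card_compl, hcard]
      obtain ⟨k, rfl⟩ := Nat.exists_eq_add_of_le' hm
      simp [ZMod.card, pow_succ]
      omega
  refine ⟨fun h hy => hfree x hx y hy h, fun hy => ?_⟩
  obtain ⟨z, hz, rfl⟩ := Finset.mem_image.mp (himage ▸ Finset.mem_compl.mpr hy)
  simpa [← add_assoc, ZModModule.add_self] using hz

/-- A half-size design without zero-sum triples is the complement of a hyperplane. -/
lemma exists_linearMap_mem_iff {m : ℕ} (hm : 1 ≤ m) {d : Finset (V m)} (hd : d ⊆ Hm m)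
    (hcard : d.card = 2 ^ (m - 1)) (ha3 : wordCount m d 3 = 0) :
    ∃ φ : V m →ₗ[ZMod 2] ZMod 2, φ ≠ 0 ∧ ∀ v : V m, v ∈ d ↔ φ v = 1 := by
  have key : ∀ x ∈ d, ∀ y, x + y ∈ d ↔ y ∉ d := fun x hx y =>
    add_mem_iff_notMem_of_sumFree hm hcard
      (fun _ h₁ _ h₂ => add_notMem_of_wordCount_three_eq_zero hd ha3 h₁ h₂) hx y
  obtain ⟨x, hx⟩ : d.Nonempty := Finset.card_pos.mp (hcard ▸ by positivity)
  have h0 : (0 : V m) ∉ d := fun h => (Finset.mem_filter.mp (hd h)).2 rfl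
  have hadd : ∀ a b, a + b ∈ d ↔ ¬(a ∈ d ↔ b ∈ d) := by
    intro a b
    by_cases ha : a ∈ d
    · simp [key a ha b, ha]
    · have h₁ := key (x + a) ((key x hx a).mpr ha) b
      have h₂ := key x hx (a + b)
      rw [← add_assoc] at h₂
      tauto
  let f : V m →+ ZMod 2 :=
    { toFun := fun v => if v ∈ d then 1 else 0
      map_zero' := if_neg h0
      map_add' := fun a b => by
        by_cases ha : a ∈ d <;> by_cases hb : b ∈ d <;> simp [hadd, ha, hb]
        exact (CharTwo.add_self_eq_zero (1 : ZMod 2)).symm }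
  have hf : ∀ v, v ∈ d ↔ f.toZModLinearMap 2 v = 1 := fun v => by
    change _ ↔ (if v ∈ d then (1 : ZMod 2) else 0) = 1
    by_cases hv : v ∈ d <;> simp [hv]
  refine ⟨f.toZModLinearMap 2, fun h => ?_, hf⟩
  have := (hf x).mp hx
  simp [h] at this

/-- Any two nonzero functionals over `𝔽₂` take the value `1` at a common vector. -/
lemma exists_apply_eq_one_and_apply_eq_one {M : Type*} [AddCommGroup M] [Module (ZMod 2) M]
    {φ ψ : M →ₗ[ZMod 2] ZMod 2} (hφ : φ ≠ 0) (hψ : ψ ≠ 0) : ∃ x, φ x = 1 ∧ ψ x = 1 := by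
  have eq_one : ∀ c : ZMod 2, c ≠ 0 → c = 1 := by decide
  obtain ⟨a, ha⟩ := DFunLike.ne_iff.mp hφ
  obtain ⟨b, hb⟩ := DFunLike.ne_iff.mp hψ
  replace ha := eq_one _ ha
  replace hb := eq_one _ hb
  by_cases hψa : ψ a = 0
  · by_cases hφb : φ b = 0
    · exact ⟨a + b, by simp [ha, hφb], by simp [hb, hψa]⟩
    · exact ⟨b, eq_one _ hφb, hb⟩
  · exact ⟨a, ha, eq_one _ hψa⟩

/-- Linear automorphisms act transitively on nonzero functionals over `𝔽₂`. -/
lemma exists_linearEquiv_apply_eq {M : Type*} [AddCommGroup M] [Module (ZMod 2) M]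
    {φ ψ : M →ₗ[ZMod 2] ZMod 2} (hφ : φ ≠ 0) (hψ : ψ ≠ 0) :
    ∃ T : M ≃ₗ[ZMod 2] M, ∀ v, ψ (T v) = φ v := by
  obtain ⟨x, hφx, hψx⟩ := exists_apply_eq_one_and_apply_eq_one hφ hψ
  let t : M →ₗ[ZMod 2] M := LinearMap.id + (φ + ψ).smulRight x
  have ht : ∀ v, t v = v + (φ v + ψ v) • x := fun v => by simp [t]
  have cancel : ∀ a b : ZMod 2, b + (a + b) = a := by decide
  have hψt : ∀ v, ψ (t v) = φ v := fun v => by simp [ht, hψx, cancel]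
  have hφt : ∀ v, φ (t v) = ψ v := fun v => by
    simp [ht, hφx, add_comm (φ v) (ψ v), cancel]
  have htt : ∀ v, t (t v) = v := fun v => by
    rw [ht (t v), hψt, hφt, ht v, add_assoc, ← add_smul, add_comm (ψ v) (φ v),
      CharTwo.add_self_eq_zero, zero_smul, add_zero]
  exact ⟨LinearEquiv.ofInvolutive t htt, hψt⟩

/-- A design `d ⊆ H_m` of cardinality `2^{m-1}` with no zero-sum triple
is the set of vectors on which some nonzero linear functional takes the value `1`;
in particular, such a design is unique up to linear isomorphism. -/
theorem resolution_IV_design_unique (m : ℕ) (hm : 2 ≤ m)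
    (d : Finset (V m)) (hd : d ⊆ Hm m) (hcard : d.card = 2 ^ (m - 1))
    (ha3 : wordCount m d 3 = 0) :
    (∃ φ : V m →ₗ[ZMod 2] ZMod 2, φ ≠ 0 ∧ ∀ v : V m, v ∈ d ↔ φ v = 1) ∧
    (∀ d' ⊆ Hm m, d'.card = 2 ^ (m - 1) → wordCount m d' 3 = 0 →
      ∃ T : V m ≃ₗ[ZMod 2] V m, d.image (fun x => T x) = d') := by
  have hm' : 1 ≤ m := by omega
  obtain ⟨φ, hφ, hdφ⟩ := exists_linearMap_mem_iff hm' hd hcard ha3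
  refine ⟨⟨φ, hφ, hdφ⟩, fun d' hd' hcard' ha3' => ?_⟩
  obtain ⟨ψ, hψ, hdψ⟩ := exists_linearMap_mem_iff hm' hd' hcard' ha3'
  obtain ⟨T, hT⟩ := exists_linearEquiv_apply_eq hφ hψ
  refine ⟨T, ?_⟩
  ext v
  rw [Finset.mem_image, hdψ]
  constructor
  · rintro ⟨w, hw, rfl⟩
    rw [hT, ← hdφ]
    exact hw
  · intro hv
    refine ⟨T.symm v, ?_, T.apply_symm_apply v⟩
    rw [hdφ, ← hT, T.apply_symm_apply, hv]
end

section
/- For every odd natural number i and every v ∈ O_m, the number of i-element subsets S of O_m whose elements sum to v satisfies 2^{m−1}·#{S ⊆ O_m : |S| = i, ∑S = v} = C(2^{m−1}, i). In particular this count is the same for every v ∈ O_m. -/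
open Finset Polynomial

theorem mem_Om {m : ℕ} {v : V m} : v ∈ Om m ↔ ∑ i, v i = 1 := by simp [Om]

theorem card_Om {m : ℕ} (hm : 1 ≤ m) : (Om m).card = 2 ^ (m - 1) := by
  let e : V m := Pi.single ⟨0, hm⟩ 1
  have he : ∑ i, e i = 1 := by simp [e]
  have hcompl : (Om m)ᶜ.card = (Om m).card := by
    refine card_equiv (Equiv.addLeft e) fun x => ?_
    simp only [mem_compl, mem_Om, Equiv.coe_addLeft, Pi.add_apply, sum_add_distrib, he]
    generalize ∑ i, x i = a
    revert a
    decide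
  have htotal := card_add_card_compl (Om m)
  have hV : Fintype.card (V m) = 2 * 2 ^ (m - 1) := by
    rw [← pow_succ', Nat.sub_add_cancel hm]
    simp [ZMod.card]
  omega

theorem nsmul_eq_self_of_odd {m i : ℕ} (hi : Odd i) (c : V m) : i • c = c := by
  ext j
  simp [ZMod.natCast_eq_one_iff_odd.mpr hi]

theorem sum_mem_Om {m : ℕ} {S : Finset (V m)} (hS : S ⊆ Om m) (hodd : Odd S.card) :
    S.sum id ∈ Om m := by
  rw [mem_Om]
  simp only [Finset.sum_apply, id]
  rw [sum_comm, sum_congr rfl fun x hx => mem_Om.mp (hS hx)]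
  simpa using ZMod.natCast_eq_one_iff_odd.mpr hodd

/-- Translation by `w - v` carries the `i`-subsets with sum `v` into those with sum `w`. -/
theorem sumCount_Om_le {m i : ℕ} (hi : Odd i) {v w : V m} (hv : v ∈ Om m) (hw : w ∈ Om m) :
    sumCount m (Om m) i v ≤ sumCount m (Om m) i w := by
  refine card_le_card_of_injOn (fun S => S.map (Equiv.addLeft (w - v)).toEmbedding) ?_
    (map_injective _).injOn
  intro S hS
  simp only [coe_filter, mem_powersetCard, Set.mem_ofPred_eq] at hS ⊢
  obtain ⟨⟨hsub, hcard⟩, hsum⟩ := hS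
  refine ⟨⟨?_, by rw [card_map, hcard]⟩, ?_⟩
  · intro y hy
    obtain ⟨x, hx, rfl⟩ := mem_map.mp hy
    have hx' := hsub hx
    rw [mem_Om] at *
    simp [sum_add_distrib, hv, hw, hx']
  · rw [sum_map]
    change ∑ x ∈ S, ((w - v) + id x) = w
    rw [sum_add_distrib, sum_const, hcard, hsum, nsmul_eq_self_of_odd hi, sub_add_cancel]

/-- For odd `i` and any `v ∈ O_m`, the number of `i`-element subsets
of `O_m` summing to `v` satisfies `2^{m-1} · #{S} = C(2^{m-1}, i)`; in particular it is
the same for every `v ∈ O_m`. -/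
theorem odd_sum_count_constant_on_Om (m : ℕ) (hm : 2 ≤ m)
    (i : ℕ) (hi : Odd i) (v : V m) (hv : v ∈ Om m) :
    2 ^ (m - 1) * sumCount m (Om m) i v = Nat.choose (2 ^ (m - 1)) i := by
  have hmaps : ((powersetCard i (Om m) : Finset (Finset (V m))) : Set (Finset (V m))).MapsTo
      (fun S => S.sum id) (Om m) := fun S hS => by
    obtain ⟨hsub, hcard⟩ := mem_powersetCard.mp (mem_coe.mp hS)
    exact sum_mem_Om hsub (hcard ▸ hi)
  have hfiber : ∀ w ∈ Om m, sumCount m (Om m) i w = sumCount m (Om m) i v := fun w hw =>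
    le_antisymm (sumCount_Om_le hi hw hv) (sumCount_Om_le hi hv hw)
  have hcount := card_eq_sum_card_fiberwise hmaps
  rw [card_powersetCard] at hcount
  change _ = ∑ w ∈ Om m, sumCount m (Om m) i w at hcount
  rw [sum_congr rfl hfiber, sum_const, smul_eq_mul, card_Om (by omega)] at hcount
  exact hcount.symm
end
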